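/- arXiv:1506.02232 — 3 statements merged into one kernel-verified Lean document; each statement's English description precedes it below -/
import Mathlib

section
/- For all integers k, ℓ > 0 there exists c such that every finite simple graph G with no clique of cardinality more than k and no induced cycle of length more than ℓ has chromatic number at most c. -/
/-- An induced cycle of length `n` in `G`: an injective cyclic sequence of vertices
whose adjacencies are exactly the consecutive pairs. -/
def InducedCycle {V : Type*} (G : SimpleGraph V) (n : ℕ) : Prop :=
  ∃ f : ZMod n → V, Function.Injective f ∧
    ∀ i j : ZMod n, G.Adj (f i) (f j) ↔ (j = i + 1 ∨ i = j + 1)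

namespace HoleColoring

variable {V : Type*} {G : SimpleGraph V}

/-- Adjacency between two vertices of `S`. -/
def AdjIn (G : SimpleGraph V) (S : Set V) (u v : V) : Prop :=
  G.Adj u v ∧ u ∈ S ∧ v ∈ S

/-- Two vertices joined by a path all of whose vertices lie in `S`. -/
abbrev Joined (G : SimpleGraph V) (S : Set V) : V → V → Prop :=
  Relation.ReflTransGen (AdjIn G S)

theorem Joined.symm {S : Set V} {u v : V} (h : Joined G S u v) : Joined G S v u := by
  induction h with
  | refl => exact .refl
  | tail _ h ih => exact .head ⟨h.1.symm, h.2.2, h.2.1⟩ ih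

theorem Joined.mono {S T : Set V} (hST : S ⊆ T) {u v : V} (h : Joined G S u v) :
    Joined G T u v := by
  induction h with
  | refl => exact .refl
  | tail _ h ih => exact ih.tail ⟨h.1, hST h.2.1, hST h.2.2⟩

theorem Joined.of_adj {S : Set V} {u v : V} (h : G.Adj u v) (hu : u ∈ S) (hv : v ∈ S) :
    Joined G S u v :=
  Relation.ReflTransGen.single ⟨h, hu, hv⟩

theorem Joined.of_seq {S : Set V} (p : ℕ → V) (n : ℕ) (hS : ∀ i ≤ n, p i ∈ S)
    (h : ∀ i < n, G.Adj (p i) (p (i + 1))) : Joined G S (p 0) (p n) := by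
  induction n with
  | zero => exact .refl
  | succ n ih =>
    exact (ih (fun i hi => hS i (by omega)) (fun i hi => h i (by omega))).tail
      ⟨h n (by omega), hS n (by omega), hS _ le_rfl⟩

theorem exists_seq {S : Set V} {a b : V} (ha : a ∈ S) (h : Joined G S a b) :
    ∃ n, ∃ p : ℕ → V, p 0 = a ∧ p n = b ∧ (∀ i ≤ n, p i ∈ S) ∧
      ∀ i < n, G.Adj (p i) (p (i + 1)) := by
  induction h with
  | refl => exact ⟨0, fun _ => a, rfl, rfl, fun _ _ => ha, by simp⟩
  | @tail b c _ hbc ih =>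
    obtain ⟨n, p, h0, hn, hS, hp⟩ := ih
    refine ⟨n + 1, fun i => if i ≤ n then p i else c, by simp [h0], by simp, ?_, ?_⟩
    · intro i hi
      dsimp only
      split_ifs with h
      · exact hS i h
      · exact hbc.2.2
    · intro i hi
      by_cases hin : i = n
      · subst hin; simpa [hn] using hbc.1
      · have h1 : i < n := by omega
        simpa [h1.le, Nat.succ_le_of_lt h1] using hp i h1

/-- A shortest path inside `S` is an induced path. -/
theorem exists_induced_path {S : Set V} {a b : V} (ha : a ∈ S) (h : Joined G S a b) :
    ∃ n, ∃ p : ℕ → V, p 0 = a ∧ p n = b ∧ (∀ i ≤ n, p i ∈ S) ∧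
      (∀ i < n, G.Adj (p i) (p (i + 1))) ∧
      ∀ i j, i < j → j ≤ n → p i ≠ p j ∧ (G.Adj (p i) (p j) → j = i + 1) := by
  classical
  have hex := exists_seq ha h
  obtain ⟨p, h0, hn, hS, hp⟩ := Nat.find_spec hex
  set n := Nat.find hex with hn_def
  have hmin : ∀ m < n, ¬ _ := fun m hm => Nat.find_min hex hm
  refine ⟨n, p, h0, hn, hS, hp, fun i j hij hjn => ⟨fun heq => ?_, fun hadj => ?_⟩⟩
  · refine hmin (n - (j - i)) (by omega)
      ⟨fun t => if t ≤ i then p t else p (t + (j - i)), by simp [h0], ?_, ?_, ?_⟩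
    · dsimp only
      split_ifs with h
      · have : n - (j - i) = i := by omega
        rw [this, heq, ← hn]; congr 1; omega
      · rw [← hn]; congr 1; omega
    · intro t ht
      dsimp only
      split_ifs with h
      · exact hS _ (by omega)
      · exact hS _ (by omega)
    · intro t ht
      dsimp only
      by_cases h1 : t + 1 ≤ i
      · rw [if_pos (by omega), if_pos h1]; exact hp t (by omega)
      · rw [if_neg h1]
        split_ifs with h2
        · have h3 : t = i := by omega
          subst h3
          rw [heq, show t + 1 + (j - t) = j + 1 by omega]
          exact hp j (by omega)
        · rw [show t + 1 + (j - i) = t + (j - i) + 1 by omega]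
          exact hp _ (by omega)
  · by_contra hne
    refine hmin (n - (j - i - 1)) (by omega)
      ⟨fun t => if t ≤ i then p t else p (t + (j - i - 1)), by simp [h0], ?_, ?_, ?_⟩
    · dsimp only
      rw [if_neg (by omega), ← hn]; congr 1; omega
    · intro t ht
      dsimp only
      split_ifs with h
      · exact hS _ (by omega)
      · exact hS _ (by omega)
    · intro t ht
      dsimp only
      by_cases h1 : t + 1 ≤ i
      · rw [if_pos (by omega), if_pos h1]; exact hp t (by omega)
      · rw [if_neg h1]
        split_ifs with h2
        · have h3 : t = i := by omega
          subst h3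
          rw [show t + 1 + (j - t - 1) = j by omega]
          exact hadj
        · rw [show t + 1 + (j - i - 1) = t + (j - i - 1) + 1 by omega]
          exact hp _ (by omega)

theorem inducedCycle_of_seq {n : ℕ} (hn : 2 ≤ n) (g : ℕ → V)
    (h : ∀ i j, i < j → j ≤ n → g i ≠ g j ∧
      (G.Adj (g i) (g j) ↔ j = i + 1 ∨ (i = 0 ∧ j = n))) :
    InducedCycle G (n + 1) := by
  have hsucc : ∀ i j : Fin (n + 1), j = i + 1 ↔
      (j : ℕ) = i + 1 ∨ ((i : ℕ) = n ∧ (j : ℕ) = 0) := by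
    intro i j
    rw [Fin.ext_iff, Fin.val_add_one]
    have hi := i.2
    have hj := j.2
    split_ifs with h1
    · subst h1; simp; omega
    · have : (i : ℕ) ≠ n := fun h => h1 (Fin.ext (by simpa using h))
      omega
  suffices H : ∃ f : Fin (n + 1) → V, Function.Injective f ∧
      ∀ i j, G.Adj (f i) (f j) ↔ (j = i + 1 ∨ i = j + 1) from H
  refine ⟨fun i => g i, ?_, ?_⟩
  · intro i j hij
    by_contra hne
    have hne' : (i : ℕ) ≠ j := fun h => hne (Fin.ext h)
    have hi := i.2
    have hj := j.2
    rcases lt_or_gt_of_ne hne' with h1 | h1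
    · exact (h _ _ h1 (by omega)).1 hij
    · exact (h _ _ h1 (by omega)).1 hij.symm
  · intro i j
    refine Iff.trans ?_ (or_congr (hsucc i j) (hsucc j i)).symm
    have hi := i.2
    have hj := j.2
    rcases lt_trichotomy (i : ℕ) j with h1 | h1 | h1
    · rw [(h _ _ h1 (by omega)).2]; omega
    · simp only [h1, SimpleGraph.irrefl, false_iff]; omega
    · rw [G.adj_comm, (h _ _ h1 (by omega)).2]; omega

/-- Two vertices far apart inside `S` and joined through `T`, with no edges between `S` and `T`
other than at these two vertices, give a long induced cycle. -/
theorem exists_inducedCycle {S T : Set V} {a b a' b' : V} {L : ℕ} (hL : 2 ≤ L)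
    (rk : V → ℕ → Prop) (ha : a ∈ S) (hab : Joined G S a b) (hrka : rk a 0)
    (hrk : ∀ u ∈ S, ∀ v ∈ S, G.Adj u v → ∀ x, rk u x → ∃ y ≤ x + 1, rk v y)
    (hrkb : ∀ y, rk b y → L ≤ y)
    (ha' : a' ∈ T) (hb' : b' ∈ T) (hab' : Joined G T a' b') (haa : G.Adj a a')
    (hbb : G.Adj b b') (hd : ∀ s ∈ S, s ∉ T)
    (hST : ∀ s ∈ S, ∀ t ∈ T, G.Adj s t → s = a ∨ s = b) :
    ∃ n, L + 2 ≤ n ∧ InducedCycle G n := by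
  obtain ⟨n, p, p0, pn, pS, pp, pi⟩ := exists_induced_path ha hab
  have hlen : ∀ i ≤ n, ∃ x ≤ i, rk (p i) x := by
    intro i
    induction i with
    | zero => intro _; exact ⟨0, le_rfl, p0 ▸ hrka⟩
    | succ i ih =>
      intro hi
      obtain ⟨x, hx, hx'⟩ := ih (by omega)
      obtain ⟨y, hy, hy'⟩ := hrk _ (pS i (by omega)) _ (pS _ hi) (pp i (by omega)) x hx'
      exact ⟨y, by omega, hy'⟩
  have hnL : L ≤ n := by
    obtain ⟨x, hx, hx'⟩ := hlen n le_rfl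
    exact (hrkb x (pn ▸ hx')).trans hx
  have hbS : b ∈ S := pn ▸ pS n le_rfl
  have hTsub : T ⊆ T ∪ {a, b} := Set.subset_union_left
  have hjoin : Joined G (T ∪ {a, b}) a b :=
    ((Joined.of_adj haa (by simp) (hTsub ha')).trans (hab'.mono hTsub)).trans
      (Joined.of_adj hbb.symm (hTsub hb') (by simp))
  obtain ⟨m, q, q0, qm, qS, qp, qi⟩ := exists_induced_path (by simp) hjoin
  have hnab : ¬ G.Adj a b := by
    intro h
    obtain ⟨y, hy, hy'⟩ := hrk _ ha _ hbS h 0 hrka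
    have := hrkb y hy'
    omega
  have hne : a ≠ b := by rintro rfl; have := hrkb 0 hrka; omega
  have hm : 2 ≤ m := by
    rcases m with _ | _ | m
    · exact absurd (q0.symm.trans qm) hne
    · exact absurd (by have := qp 0 (by omega); rwa [q0, qm] at this) hnab
    · omega
  have qT : ∀ i, 0 < i → i < m → q i ∈ T := by
    intro i h0 hi
    rcases qS i hi.le with h | h | h
    · exact h
    · exact absurd (q0.trans h.symm) (qi 0 i h0 hi.le).1
    · exact absurd (h.trans qm.symm) (qi i m hi le_rfl).1
  refine ⟨n + m - 1 + 1, by omega, inducedCycle_of_seq (by omega)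
    (fun t => if t ≤ n then p t else q (n + m - t)) ?_⟩
  intro i j hij hj
  by_cases h1 : j ≤ n
  · rw [if_pos h1, if_pos (by omega)]
    refine ⟨(pi i j hij h1).1, ⟨fun h => .inl ((pi i j hij h1).2 h), ?_⟩⟩
    rintro (rfl | h)
    · exact pp i (by omega)
    · omega
  · rw [if_neg h1]
    have hjT := qT (n + m - j) (by omega) (by omega)
    by_cases h2 : i ≤ n
    · rw [if_pos h2]
      refine ⟨fun h => hd _ (pS i h2) (h ▸ hjT), ?_⟩
      constructor
      · intro h
        rcases hST _ (pS i h2) _ hjT h with h3 | h3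
        · have hi0 : i = 0 := by
            by_contra h4
            exact (pi 0 i (by omega) h2).1 (p0.trans h3.symm)
          right
          refine ⟨hi0, ?_⟩
          rw [h3, ← q0] at h
          have := (qi 0 (n + m - j) (by omega) (by omega)).2 h
          omega
        · have hin : i = n := by
            by_contra h4
            exact (pi i n (by omega) le_rfl).1 (h3.trans pn.symm)
          left
          rw [h3, ← qm] at h
          have := (qi (n + m - j) m (by omega) le_rfl).2 h.symm
          omega
      · rintro (rfl | ⟨rfl, rfl⟩)
        · have hin : i = n := by omega
          subst hin
          have := qp (m - 1) (by omega)
          rw [show m - 1 + 1 = m by omega, qm] at this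
          rw [pn, show i + m - (i + 1) = m - 1 by omega]
          exact this.symm
        · rw [p0, show n + m - (n + m - 1) = 0 + 1 by omega, ← q0]
          exact qp 0 (by omega)
    · rw [if_neg h2]
      have hq := qi (n + m - j) (n + m - i) (by omega) (by omega)
      refine ⟨hq.1.symm, ⟨fun h => ?_, ?_⟩⟩
      · have := hq.2 h.symm
        omega
      · rintro (rfl | h)
        · have := qp (n + m - (i + 1)) (by omega)
          rw [show n + m - (i + 1) + 1 = n + m - i by omega] at this
          exact this.symm
        · omega

/-- The subgraph of `G` induced on `S` has a proper colouring with `n` colours. -/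
def Col (G : SimpleGraph V) (S : Set V) (n : ℕ) : Prop :=
  ∃ f : V → ℕ, (∀ v ∈ S, f v < n) ∧ ∀ u ∈ S, ∀ v ∈ S, G.Adj u v → f u ≠ f v

theorem Col.mono {S T : Set V} {m n : ℕ} (hST : S ⊆ T) (hmn : m ≤ n) (h : Col G T m) :
    Col G S n := by
  obtain ⟨f, h1, h2⟩ := h
  exact ⟨f, fun v hv => (h1 v (hST hv)).trans_le hmn,
    fun u hu v hv => h2 u (hST hu) v (hST hv)⟩

theorem Col.of_subset_union {S A B : Set V} {a b : ℕ} (hS : S ⊆ A ∪ B) (hA : Col G A a)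
    (hB : Col G B b) : Col G S (a + b) := by
  classical
  obtain ⟨f, f1, f2⟩ := hA
  obtain ⟨g, g1, g2⟩ := hB
  have hB' : ∀ v ∈ S, v ∉ A → v ∈ B := fun v hv h => (hS hv).resolve_left h
  refine ⟨fun v => if v ∈ A then f v else a + g v, fun v hv => ?_, fun u hu v hv huv => ?_⟩
  · dsimp only
    split_ifs with h
    · have := f1 v h; omega
    · have := g1 v (hB' v hv h); omega
  · dsimp only
    split_ifs with h h' h'
    · exact f2 u h v h' huv
    · have := f1 u h; omega
    · have := f1 v h'; omega
    · have := g2 u (hB' u hu h) v (hB' v hv h') huv; omega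

theorem Col.empty : Col G ∅ 0 := ⟨fun _ => 0, by simp, by simp⟩

theorem Col.singleton (v : V) : Col G {v} 1 :=
  ⟨fun _ => 0, by simp, by rintro u rfl w rfl h; exact absurd h (G.irrefl)⟩

theorem nonempty_of_not_col {S : Set V} {n : ℕ} (h : ¬ Col G S n) : S.Nonempty := by
  by_contra hS
  rw [Set.not_nonempty_iff_eq_empty] at hS
  subst hS
  exact h (Col.empty.mono subset_rfl (Nat.zero_le _))

theorem Col.biUnion {ι : Type*} (s : Finset ι) (A : ι → Set V) {c : ℕ}
    (h : ∀ i ∈ s, Col G (A i) c) : Col G (⋃ i ∈ s, A i) (s.card * c) := by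
  classical
  induction s using Finset.induction_on with
  | empty => simpa using Col.empty
  | insert i s hi ih =>
    rw [Finset.card_insert_of_notMem hi, Nat.succ_mul, Nat.add_comm]
    refine Col.of_subset_union (A := A i) (B := ⋃ j ∈ s, A j) ?_ (h i (by simp))
      (ih fun j hj => h j (by simp [hj]))
    rw [Finset.set_biUnion_insert]

/-- A set that is not cheaply colourable has a large part outside finitely many cheap sets. -/
theorem not_col_diff {ι : Type*} {S : Set V} (s : Finset ι) (A : ι → Set V) {c n : ℕ}
    (hS : ¬ Col G S (n + s.card * c)) (h : ∀ i ∈ s, Col G (A i) c) :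
    ¬ Col G {u ∈ S | ∀ i ∈ s, u ∉ A i} n := by
  intro h'
  refine hS (Col.of_subset_union ?_ h' (Col.biUnion s A h))
  intro u hu
  by_cases h1 : ∀ i ∈ s, u ∉ A i
  · exact .inl ⟨hu, h1⟩
  · push Not at h1
    obtain ⟨i, hi, hi'⟩ := h1
    exact .inr (Set.mem_biUnion (show i ∈ (s : Set ι) from hi) hi')

/-- The set `F` induces a connected subgraph (or is empty). -/
def Conn (G : SimpleGraph V) (F : Set V) : Prop := ∀ a ∈ F, ∀ b ∈ F, Joined G F a b

theorem Conn.singleton (v : V) : Conn G {v} := by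
  rintro a rfl b rfl
  exact .refl

theorem exists_component {S : Set V} {n : ℕ} (h : ¬ Col G S n) :
    ∃ F ⊆ S, Conn G F ∧ ¬ Col G F n ∧ ∀ u ∈ F, ∀ v ∈ S, G.Adj u v → v ∈ F := by
  classical
  set cmp : V → Set V := fun v => {u | u ∈ S ∧ Joined G S v u} with hcmp
  by_cases hall : ∀ v ∈ S, Col G (cmp v) n
  · refine absurd ?_ h
    have hall' : ∀ A : Set V, ∃ f : V → ℕ, Col G A n →
        (∀ v ∈ A, f v < n) ∧ ∀ u ∈ A, ∀ v ∈ A, G.Adj u v → f u ≠ f v := by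
      intro A
      by_cases hA : Col G A n
      · obtain ⟨f, hf⟩ := hA
        exact ⟨f, fun _ => hf⟩
      · exact ⟨fun _ => 0, fun h => absurd h hA⟩
    choose f hf using hall'
    refine ⟨fun v => f (cmp v) v, fun v hv => (hf _ (hall v hv)).1 v ⟨hv, .refl⟩, ?_⟩
    intro u hu v hv huv
    have huv' : Joined G S u v := Joined.of_adj huv hu hv
    have heq : cmp u = cmp v := by
      ext x
      exact ⟨fun hx => ⟨hx.1, huv'.symm.trans hx.2⟩, fun hx => ⟨hx.1, huv'.trans hx.2⟩⟩
    dsimp only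
    rw [heq]
    exact (hf _ (hall v hv)).2 u ⟨hu, huv'.symm⟩ v ⟨hv, .refl⟩ huv
  · push Not at hall
    obtain ⟨v, hv, hcol⟩ := hall
    have hjoin : ∀ a, Joined G S v a → Joined G (cmp v) v a := by
      intro a ha
      induction ha with
      | refl => exact .refl
      | tail h1 h2 ih => exact ih.tail ⟨h2.1, ⟨h2.2.1, h1⟩, ⟨h2.2.2, h1.tail h2⟩⟩
    refine ⟨cmp v, fun u hu => hu.1, fun a ha b hb =>
      (hjoin a ha.2).symm.trans (hjoin b hb.2), hcol, fun u hu w hw huw =>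
      ⟨hw, hu.2.tail ⟨huw, hu.1, hw⟩⟩⟩

/-- A path from outside `F` into `F` crosses the boundary of `F`. -/
theorem Joined.exists_boundary {S F : Set V} {a b : V} (h : Joined G S a b) (ha : a ∉ F)
    (hb : b ∈ F) : ∃ u v, G.Adj u v ∧ u ∈ S ∧ u ∉ F ∧ v ∈ F := by
  induction h with
  | refl => exact absurd hb ha
  | @tail x y _ h2 ih =>
    by_cases hx : x ∈ F
    · exact ih hx
    · exact ⟨x, y, h2.1, h2.2.1, hx, hb⟩

/-- The Gyárfás path: an induced path starting in `N` and leading through `C` to a connected part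
of `C` that is hard to colour. -/
theorem exists_gyarfas_path {τ : ℕ} (hτ : ∀ v, Col G (G.neighborSet v) τ) {N C : Set V}
    (hNC : ∀ n ∈ N, n ∉ C) (hC : ∀ u ∈ C, ∃ n ∈ N, G.Adj n u) (m : ℕ) :
    ∀ R, ¬ Col G C (m * τ + R) → ∃ (p : ℕ → V) (F : Set V), F ⊆ C ∧ Conn G F ∧ ¬ Col G F R ∧
      p 0 ∈ N ∧ (∀ a, 1 ≤ a → a ≤ m → p a ∈ C) ∧ (∀ a < m, G.Adj (p a) (p (a + 1))) ∧
      (∀ a < m, ∀ u ∈ F, ¬ G.Adj (p a) u) ∧ (∀ a ≤ m, p a ∉ F) ∧ (∃ u ∈ F, G.Adj (p m) u) ∧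
      (∀ a b, a + 1 < b → b ≤ m → ¬ G.Adj (p a) (p b)) ∧ ∀ a b, a < b → b ≤ m → p a ≠ p b := by
  classical
  induction m with
  | zero =>
    intro R hR
    obtain ⟨F, hFC, hF, hFR, -⟩ := exists_component (by simpa using hR)
    obtain ⟨u, hu⟩ := nonempty_of_not_col hFR
    obtain ⟨n, hn, hnu⟩ := hC u (hFC hu)
    exact ⟨fun _ => n, F, hFC, hF, hFR, hn, fun a h1 h2 => by omega, by simp, by simp,
      fun a _ h => hNC n hn (hFC h), ⟨u, hu, hnu⟩, fun a b h1 h2 => by omega,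
      fun a b h1 h2 => by omega⟩
  | succ m ih =>
    intro R hR
    obtain ⟨p, F, hFC, hF, hFR, p0, pC, pp, pF, pF', ⟨u, hu, hpu⟩, pn, pi⟩ := ih (R + τ) (by
      intro h; exact hR (h.mono subset_rfl (by rw [Nat.succ_mul]; omega)))
    have h1 : ¬ Col G (F \ G.neighborSet (p m)) R := by
      intro h
      refine hFR (Col.of_subset_union ?_ h (hτ (p m)))
      intro x hx
      by_cases hx' : x ∈ G.neighborSet (p m)
      · exact .inr hx'
      · exact .inl ⟨hx, hx'⟩
    obtain ⟨F', hF'F, hF', hFR', hcl⟩ := exists_component h1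
    obtain ⟨x, hx⟩ := nonempty_of_not_col hFR'
    obtain ⟨y, z, hyz, hyF, hyF', hzF'⟩ := (hF u hu x (hF'F hx).1).exists_boundary
      (F := F') (fun h => (hF'F h).2 hpu) hx
    have hy : G.Adj (p m) y := by
      by_contra hy
      exact hyF' (hcl z hzF' y ⟨hyF, hy⟩ hyz.symm)
    have e1 : ∀ a ≤ m, (if a ≤ m then p a else y) = p a := fun a h => if_pos h
    have e2 : (if m + 1 ≤ m then p (m + 1) else y) = y := if_neg (by omega)
    refine ⟨fun a => if a ≤ m then p a else y, F', fun v hv => hFC (hF'F hv).1, hF', hFR', ?_,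
      ?_, ?_, ?_, ?_, ?_, ?_, ?_⟩
    · simpa using p0
    · intro a h1 h2
      dsimp only
      split_ifs with h
      · exact pC a h1 h
      · exact hFC hyF
    · intro a ha
      dsimp only
      rw [e1 a (by omega)]
      by_cases h : a = m
      · subst h; rw [e2]; exact hy
      · rw [e1 _ (by omega)]; exact pp a (by omega)
    · intro a ha v hv
      dsimp only
      rw [e1 a (by omega)]
      by_cases h : a = m
      · subst h; exact (hF'F hv).2
      · exact pF a (by omega) v (hF'F hv).1
    · intro a ha hv
      dsimp only at hv
      split_ifs at hv with h
      · exact pF' a h (hF'F hv).1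
      · exact hyF' hv
    · exact ⟨z, hzF', by dsimp only; rw [e2]; exact hyz⟩
    · intro a b hab hb
      dsimp only
      rw [e1 a (by omega)]
      split_ifs with h
      · exact pn a b hab h
      · exact pF a (by omega) y hyF
    · intro a b hab hb
      dsimp only
      rw [e1 a (by omega)]
      split_ifs with h
      · exact pi a b hab h
      · rintro rfl; exact pF' a (by omega) hyF

/-- If `N` covers `C` and is attached to a connected set anticomplete to `C`, and no vertex of `C`
is close to a hard part of `C` through `N`, then `C` is easy to colour. -/
theorem col_of_levelling {τ c m : ℕ} (hm : 2 ≤ m) (hG : ∀ n, m + 2 ≤ n → ¬ InducedCycle G n)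
    (hτ : ∀ v, Col G (G.neighborSet v) τ) {U N C : Set V} (hU : Conn G U)
    (hUC : ∀ u ∈ U, ∀ v ∈ C, u ≠ v ∧ ¬ G.Adj u v) (hUN : ∀ n ∈ N, n ∉ U)
    (hNC : ∀ n ∈ N, n ∉ C) (hN : ∀ n ∈ N, ∃ u ∈ U, G.Adj n u)
    (hC : ∀ u ∈ C, ∃ n ∈ N, G.Adj n u)
    (hp : ∀ p ∈ C, Col G {u ∈ C | ∃ n ∈ N, G.Adj n u ∧ G.Adj n p} c) :
    Col G C (m * τ + m * c) := by
  classical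
  by_contra hcol
  obtain ⟨p, F, hFC, hF, hFR, p0, pC, pp, pF, pF', ⟨w, hw, hpw⟩, pn, pi⟩ :=
    exists_gyarfas_path hτ hNC hC m _ hcol
  have hbig := not_col_diff (Finset.Ico 1 m) (n := 0) (c := c)
    (fun a => {u ∈ C | ∃ n ∈ N, G.Adj n u ∧ G.Adj n (p a)})
    (S := F) (fun h => hFR (h.mono subset_rfl (by
      rw [Nat.card_Ico, Nat.zero_add]; exact Nat.mul_le_mul_right _ (by omega))))
    (fun a ha => hp _ (pC a (Finset.mem_Ico.1 ha).1 (Finset.mem_Ico.1 ha).2.le))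
  obtain ⟨u, huF, hu⟩ := nonempty_of_not_col hbig
  obtain ⟨n, hn, hnu⟩ := hC u (hFC huF)
  have hna : ∀ a, 1 ≤ a → a < m → ¬ G.Adj n (p a) := fun a h1 h2 h3 =>
    hu a (Finset.mem_Ico.2 ⟨h1, h2⟩) ⟨hFC huF, n, hn, hnu, h3⟩
  obtain ⟨u0, hu0, hpu0⟩ := hN _ p0
  obtain ⟨u1, hu1, hnu1⟩ := hN _ hn
  obtain ⟨k, hk, hk'⟩ := exists_inducedCycle (G := G) (S := {v | ∃ a ≤ m, p a = v})
    (T := U ∪ {n} ∪ F) (a := p 0) (b := p m) (a' := u0) (b' := w) hm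
    (fun v x => x ≤ m ∧ p x = v) ⟨0, by omega, rfl⟩
    (Joined.of_seq p m (fun i hi => ⟨i, hi, rfl⟩) pp) ⟨by omega, rfl⟩ (by
      rintro _ ⟨a, ha, rfl⟩ _ ⟨b, hb, rfl⟩ hab x ⟨hx, hxa⟩
      refine ⟨b, ?_, hb, rfl⟩
      by_contra hlt
      rw [← hxa] at hab
      exact pn x b (by omega) hb hab) (by
      rintro y ⟨hy, hym⟩
      by_contra hlt
      exact pi y m (by omega) le_rfl hym) (.inl (.inl hu0)) (.inr hw)
    (((hU u0 hu0 u1 hu1).mono fun x hx => .inl (.inl hx)).trans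
      ((Joined.of_adj hnu1.symm (.inl (.inl hu1)) (.inl (.inr rfl))).trans
      ((Joined.of_adj hnu (.inl (.inr rfl)) (.inr huF)).trans
      ((hF u huF w hw).mono fun x hx => .inr hx)))) hpu0 hpw (by
      rintro _ ⟨a, ha, rfl⟩ hT
      rcases Nat.eq_zero_or_pos a with rfl | ha0
      · rcases hT with (hT | hT) | hT
        · exact hUN _ p0 hT
        · rw [Set.mem_singleton_iff] at hT
          exact pF 0 (by omega) u huF (hT ▸ hnu)
        · exact hNC _ p0 (hFC hT)
      · rcases hT with (hT | hT) | hT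
        · exact (hUC _ hT _ (pC a ha0 ha)).1 rfl
        · rw [Set.mem_singleton_iff] at hT
          exact hNC n hn (hT ▸ pC a ha0 ha)
        · exact pF' a ha hT) (by
      rintro _ ⟨a, ha, rfl⟩ t ht hat
      by_cases ha0 : a = 0
      · left; rw [ha0]
      by_cases ham : a = m
      · right; rw [ham]
      exfalso
      rcases ht with (ht | ht) | ht
      · exact (hUC _ ht _ (pC a (by omega) ha)).2 hat.symm
      · rw [Set.mem_singleton_iff] at ht
        exact hna a (by omega) (by omega) (ht ▸ hat.symm)
      · exact pF a (by omega) t ht hat)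
  exact hG k hk hk'

/-- Ramsey's theorem for increasing lists of length `r`. -/
theorem ramsey_list {κ : Type*} [Finite κ] [Nonempty κ] (r : ℕ) : ∀ m : ℕ, ∃ t : ℕ,
    ∀ A : Finset ℕ, t ≤ A.card → ∀ f : List ℕ → κ, ∃ B ⊆ A, m ≤ B.card ∧
      ∃ col, ∀ l : List ℕ, l.Pairwise (· < ·) → l.length = r → (∀ x ∈ l, x ∈ B) → f l = col := by
  classical
  have := Fintype.ofFinite κ
  induction r with
  | zero =>
    exact fun m => ⟨m, fun A hA f => ⟨A, subset_rfl, hA, f [], fun l _ hl _ => by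
      rw [List.length_eq_zero_iff.1 hl]⟩⟩
  | succ r ih =>
    have key : ∀ m : ℕ, ∃ t : ℕ, ∀ A : Finset ℕ, t ≤ A.card → ∀ f : List ℕ → κ,
        ∃ B ⊆ A, m ≤ B.card ∧ ∃ φ : ℕ → κ, ∀ a ∈ B, ∀ l : List ℕ,
          (a :: l).Pairwise (· < ·) → l.length = r → (∀ x ∈ l, x ∈ B) → f (a :: l) = φ a := by
      intro m
      induction m with
      | zero => exact ⟨0, fun A _ f => ⟨∅, by simp, by simp, fun _ => Classical.arbitrary κ,
          by simp⟩⟩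
      | succ m ihm =>
        obtain ⟨t, ht⟩ := ihm
        obtain ⟨t', ht'⟩ := ih t
        refine ⟨t' + 1, fun A hA f => ?_⟩
        have hne : A.Nonempty := Finset.card_pos.1 (by omega)
        set a := A.min' hne with ha
        have haA : a ∈ A := A.min'_mem hne
        obtain ⟨A', hA'A, hA't, col, hcol⟩ := ht' (A.erase a)
          (by rw [Finset.card_erase_of_mem haA]; omega) (fun l => f (a :: l))
        obtain ⟨B, hBA, hBm, φ, hφ⟩ := ht A' hA't f
        have hlt : ∀ b ∈ B, a < b := fun b hb => by
          have h1 := Finset.mem_erase.1 (hA'A (hBA hb))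
          exact lt_of_le_of_ne (A.min'_le b h1.2) h1.1.symm
        have haB : a ∉ B := fun h => lt_irrefl _ (hlt a h)
        refine ⟨insert a B, Finset.insert_subset haA
          ((hBA.trans hA'A).trans (Finset.erase_subset _ _)), ?_,
          fun x => if x = a then col else φ x, ?_⟩
        · rw [Finset.card_insert_of_notMem haB]; omega
        · intro b hb l hl hlr hlB
          have hlB' : ∀ x ∈ l, x ∈ B := by
            intro x hx
            refine (Finset.mem_insert.1 (hlB x hx)).resolve_left ?_
            rintro rfl
            have h1 := (List.pairwise_cons.1 hl).1 _ hx
            rcases Finset.mem_insert.1 hb with h2 | h2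
            · omega
            · have := hlt b h2; omega
          dsimp only
          rcases Finset.mem_insert.1 hb with rfl | h2
          · rw [if_pos rfl]
            exact hcol l (List.pairwise_cons.1 hl).2 hlr fun x hx => hBA (hlB' x hx)
          · rw [if_neg (by have := hlt b h2; omega)]
            exact hφ b h2 l hl hlr hlB'
    intro m
    obtain ⟨t, ht⟩ := key (Fintype.card κ * m)
    refine ⟨t, fun A hA f => ?_⟩
    obtain ⟨B, hBA, hBm, φ, hφ⟩ := ht A hA f
    obtain ⟨col, -, hcol⟩ := Finset.exists_le_card_fiber_of_mul_le_card_of_maps_to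
      (s := B) (t := Finset.univ) (f := φ) (n := m) (fun _ _ => Finset.mem_univ _)
      Finset.univ_nonempty hBm
    refine ⟨B.filter fun x => φ x = col, (Finset.filter_subset _ _).trans hBA, hcol, col, ?_⟩
    intro l hl hlr hlB
    match l, hlr with
    | a :: l, hlr =>
      have h1 := Finset.mem_filter.1 (hlB a (by simp))
      rw [hφ a h1.1 l hl (by simpa using hlr)
        fun x hx => (Finset.mem_filter.1 (hlB x (by simp [hx]))).1, h1.2]

/-- Ramsey's theorem for triples, in terms of an increasing sequence. -/
theorem ramsey_triples (κ : Type*) [Finite κ] [Nonempty κ] (m : ℕ) : ∃ t : ℕ,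
    ∀ f : ℕ → ℕ → ℕ → κ, ∃ g : ℕ → ℕ, (∀ a b, a < b → b < m → g a < g b) ∧
      (∀ a < m, g a < t) ∧
      ∃ col, ∀ a b c, a < b → b < c → c < m → f (g a) (g b) (g c) = col := by
  classical
  obtain ⟨t, ht⟩ := ramsey_list (κ := κ) 3 m
  refine ⟨t, fun f => ?_⟩
  obtain ⟨B, hB, hBm, col, hcol⟩ := ht (Finset.range t) (by simp)
    (fun l => f (l.getD 0 0) (l.getD 1 0) (l.getD 2 0))
  have hg : ∀ a, ∃ x, ∀ h : a < m, x = B.orderEmbOfFin rfl ⟨a, h.trans_le hBm⟩ := by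
    intro a
    by_cases h : a < m
    · exact ⟨B.orderEmbOfFin rfl ⟨a, h.trans_le hBm⟩, fun _ => rfl⟩
    · exact ⟨0, fun h' => absurd h' h⟩
  choose g hg using hg
  have hgB : ∀ a < m, g a ∈ B := fun a h => by rw [hg a h]; exact Finset.orderEmbOfFin_mem _ _ _
  have hlt : ∀ a b, a < b → b < m → g a < g b := by
    intro a b hab hb
    rw [hg a (hab.trans hb), hg b hb]
    exact (B.orderEmbOfFin rfl).strictMono hab
  refine ⟨g, hlt, fun a h => Finset.mem_range.1 (hB (hgB a h)), col, ?_⟩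
  intro a b c hab hbc hc
  have h1 := hlt a b hab (hbc.trans hc)
  have h2 := hlt b c hbc hc
  have := hcol [g a, g b, g c] (by simp [h1, h2, h1.trans h2]) rfl (by
    simp [hgB _ hc, hgB _ (hbc.trans hc), hgB _ (hab.trans (hbc.trans hc))])
  simpa using this

/-- Vertices reachable from `r` by a walk of length exactly `n` inside `F`. -/
def walkSet (G : SimpleGraph V) (F : Set V) (r : V) : ℕ → Set V
  | 0 => {r}
  | n + 1 => {v | ∃ u ∈ walkSet G F r n, AdjIn G F u v}

theorem exists_level_fun {F : Set V} (hF : Conn G F) {r : V} (hr : r ∈ F) :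
    ∃ d : V → ℕ, d r = 0 ∧ (∀ v ∈ F, d v = 0 → v = r) ∧
      (∀ u ∈ F, ∀ v ∈ F, G.Adj u v → d v ≤ d u + 1) ∧
      ∀ j, ∀ v ∈ F, d v = j + 1 → ∃ u ∈ F, d u = j ∧ G.Adj u v := by
  classical
  have hex : ∀ v, Joined G F r v → ∃ n, v ∈ walkSet G F r n := by
    intro v hv
    induction hv with
    | refl => exact ⟨0, rfl⟩
    | tail _ h ih =>
      obtain ⟨n, hn⟩ := ih
      exact ⟨n + 1, _, hn, h⟩
  have hle : ∀ v n, v ∈ walkSet G F r n → sInf {n | v ∈ walkSet G F r n} ≤ n :=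
    fun v n h => Nat.sInf_le h
  have hmem : ∀ v ∈ F, v ∈ walkSet G F r (sInf {n | v ∈ walkSet G F r n}) :=
    fun v hv => Nat.sInf_mem (s := {n | v ∈ walkSet G F r n}) (hex v (hF r hr v hv))
  have hadj : ∀ u ∈ F, ∀ v ∈ F, G.Adj u v →
      sInf {n | v ∈ walkSet G F r n} ≤ sInf {n | u ∈ walkSet G F r n} + 1 :=
    fun u hu v hv huv => hle v _ ⟨u, hmem u hu, huv, hu, hv⟩
  refine ⟨fun v => sInf {n | v ∈ walkSet G F r n}, ?_, ?_, hadj, ?_⟩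
  · exact Nat.le_zero.1 (hle r 0 rfl)
  · intro v hv h
    have := hmem v hv
    dsimp only at h
    rw [h] at this
    exact this
  · intro j v hv h
    dsimp only at h
    have h1 := hmem v hv
    rw [h] at h1
    obtain ⟨u, hu, huv⟩ := h1
    refine ⟨u, huv.2.1, ?_, huv.1⟩
    have h2 := hle u j hu
    have h3 := hadj u huv.2.1 v hv huv.1
    dsimp only
    omega

theorem col_of_levels {F : Set V} {d : V → ℕ} {q : ℕ}
    (hd : ∀ u ∈ F, ∀ v ∈ F, G.Adj u v → d v ≤ d u + 1)
    (h : ∀ j, Col G {v ∈ F | d v = j} q) : Col G F (2 * q) := by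
  choose f hf hf' using h
  refine ⟨fun v => 2 * f (d v) v + d v % 2, fun v hv => ?_, fun u hu v hv huv heq => ?_⟩
  · have := hf (d v) v ⟨hv, rfl⟩
    dsimp only
    omega
  · have h1 := hd u hu v hv huv
    have h2 := hd v hv u hu huv.symm
    dsimp only at heq
    have h3 : d u = d v := by omega
    have h4 := hf' (d v) u ⟨hu, h3⟩ v ⟨hv, rfl⟩ huv
    rw [h3] at heq
    omega

theorem not_col_sdiff_nbrs {τ : ℕ} (hτ : ∀ v, Col G (G.neighborSet v) τ) {ι : Type*} {S : Set V}
    (s : Finset ι) (x : ι → V) {n : ℕ} (hS : ¬ Col G S (n + s.card * (τ + 1))) :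
    ¬ Col G {u ∈ S | ∀ i ∈ s, x i ≠ u ∧ ¬ G.Adj (x i) u} n := by
  have := not_col_diff s (fun i => G.neighborSet (x i) ∪ {x i}) hS fun i _ =>
    Col.of_subset_union subset_rfl (hτ (x i)) (Col.singleton (x i))
  refine fun h => this (h.mono ?_ le_rfl)
  rintro u ⟨hu, h1⟩
  refine ⟨hu, fun i hi => ⟨fun h => h1 i hi (.inr h.symm), fun h => h1 i hi (.inl h)⟩⟩

/-- A clique `X` complete to `N`, where `N` covers `C` and `X` is anticomplete to `C`. -/
structure KPair (G : SimpleGraph V) {k : ℕ} (X : Fin k → V) (N C : Set V) : Prop where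
  clique : ∀ e e', e ≠ e' → G.Adj (X e) (X e')
  complete : ∀ n ∈ N, ∀ e, G.Adj n (X e)
  cover : ∀ u ∈ C, ∃ n ∈ N, G.Adj n u
  anti : ∀ e, ∀ u ∈ C, X e ≠ u ∧ ¬ G.Adj (X e) u

/-- Graphs without long holes, with bounded clique size, whose neighbourhoods are easy to
colour. -/
structure Tame (ℓ τ K : ℕ) (G : SimpleGraph V) : Prop where
  hole : ∀ n, ℓ < n → ¬ InducedCycle G n
  nbr : ∀ v, Col G (G.neighborSet v) τ
  clique : ∀ s : Finset V, G.IsClique (s : Set V) → s.card ≤ K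

theorem Tame.no_clique {ℓ τ K : ℕ} (h : Tame ℓ τ K G) (f : Fin (K + 1) → V)
    (hf : ∀ a b, a < b → G.Adj (f a) (f b)) : False := by
  classical
  have hf' : ∀ a b, a ≠ b → G.Adj (f a) (f b) := fun a b hab =>
    (lt_or_gt_of_ne hab).elim (hf a b) fun h => (hf b a h).symm
  have hinj : Function.Injective f := by
    intro a b hab
    by_contra hne
    exact G.irrefl (hab ▸ hf' a b hne)
  have := h.clique (Finset.univ.map ⟨f, hinj⟩) (by
    intro u hu v hv huv
    simp only [Finset.coe_map, Function.Embedding.coeFn_mk, Finset.coe_univ, Set.image_univ,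
      Set.mem_range] at hu hv
    obtain ⟨a, rfl⟩ := hu
    obtain ⟨b, rfl⟩ := hv
    exact hf' a b fun h => huv (h ▸ rfl))
  simp at this

theorem Tame.col_of_levelling {ℓ τ K c : ℕ} (h : Tame ℓ τ K G) {U N C : Set V} (hU : Conn G U)
    (hUC : ∀ u ∈ U, ∀ v ∈ C, u ≠ v ∧ ¬ G.Adj u v) (hUN : ∀ n ∈ N, n ∉ U)
    (hNC : ∀ n ∈ N, n ∉ C) (hN : ∀ n ∈ N, ∃ u ∈ U, G.Adj n u)
    (hC : ∀ u ∈ C, ∃ n ∈ N, G.Adj n u)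
    (hp : ∀ p ∈ C, Col G {u ∈ C | ∃ n ∈ N, G.Adj n u ∧ G.Adj n p} c) :
    Col G C ((ℓ + 2) * (τ + c)) := by
  rw [Nat.mul_add]
  exact HoleColoring.col_of_levelling (by omega) (fun n hn => h.hole n (by omega)) h.nbr hU hUC
    hUN hNC hN hC hp

/-- Every hard set of a tame graph contains a `k`-pair with a hard `C`. -/
def HasPairs (ℓ τ K k : ℕ) : Prop :=
  ∀ c, ∃ M, ∀ (V : Type) (G : SimpleGraph V), Tame ℓ τ K G → ∀ S, ¬ Col G S M →
    ∃ (X : Fin k → V) (N C : Set V), KPair G X N C ∧ (∀ e, X e ∈ S) ∧ N ⊆ S ∧ C ⊆ S ∧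
      ¬ Col G C c

theorem hasPairs_one (ℓ τ K : ℕ) : HasPairs ℓ τ K 1 := by
  classical
  intro c
  refine ⟨2 * (τ + 1 + (ℓ + 2) * (τ + (c + (τ + 1)))), fun V G hG S hS => ?_⟩
  obtain ⟨F, hFS, hF, hFcol, -⟩ := exists_component hS
  obtain ⟨r, hr⟩ := nonempty_of_not_col hFcol
  obtain ⟨d, dr, d0, dadj, dpred⟩ := exists_level_fun hF hr
  have h1 : ∃ j, ¬ Col G {v ∈ F | d v = j} (τ + 1 + (ℓ + 2) * (τ + (c + (τ + 1)))) := by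
    by_contra! h
    exact hFcol (col_of_levels dadj h)
  obtain ⟨j, hj⟩ := h1
  match j, hj with
  | 0, hj =>
    refine absurd ((Col.singleton r).mono ?_ (by omega)) hj
    rintro v ⟨hv, hv'⟩
    exact d0 v hv hv'
  | 1, hj =>
    refine absurd ((hG.nbr r).mono ?_ (by omega)) hj
    rintro v ⟨hv, hv'⟩
    obtain ⟨u, hu, hu', huv⟩ := dpred 0 v hv hv'
    exact d0 u hu hu' ▸ huv
  | j + 2, hj =>
    have hUr : ∀ i ≤ j, ∀ v ∈ F, d v = i → Joined G {v ∈ F | d v ≤ j} r v := by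
      intro i
      induction i with
      | zero => intro _ v hv h; rw [d0 v hv h]
      | succ i ih =>
        intro hi v hv h
        obtain ⟨u, hu, hu', huv⟩ := dpred i v hv h
        exact (ih (by omega) u hu hu').tail ⟨huv, ⟨hu, by omega⟩, ⟨hv, by omega⟩⟩
    have h2 : ∃ p ∈ {v ∈ F | d v = j + 2}, ¬ Col G {u ∈ {v ∈ F | d v = j + 2} |
        ∃ n ∈ {v ∈ F | d v = j + 1}, G.Adj n u ∧ G.Adj n p} (c + (τ + 1)) := by
      by_contra! h
      refine hj ((hG.col_of_levelling (U := {v ∈ F | d v ≤ j}) (fun a ha b hb =>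
        (hUr _ ha.2 a ha.1 rfl).symm.trans (hUr _ hb.2 b hb.1 rfl)) ?_ ?_ ?_ ?_ ?_ h).mono
        subset_rfl (by omega))
      · rintro u ⟨hu, hu'⟩ v ⟨hv, hv'⟩
        refine ⟨by rintro rfl; omega, fun h => ?_⟩
        have := dadj u hu v hv h
        omega
      · rintro n ⟨_, h1⟩ ⟨_, h2⟩; omega
      · rintro n ⟨_, h1⟩ ⟨_, h2⟩; omega
      · rintro n ⟨hn, h1⟩
        obtain ⟨u, hu, hu', huv⟩ := dpred j n hn h1
        exact ⟨u, ⟨hu, hu'.le⟩, huv.symm⟩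
      · rintro u ⟨hu, hu'⟩
        obtain ⟨n, hn, hn', hnu⟩ := dpred (j + 1) u hu hu'
        exact ⟨n, ⟨hn, hn'⟩, hnu⟩
    obtain ⟨p, hp, hcol⟩ := h2
    have h3 := not_col_sdiff_nbrs hG.nbr {()} (fun _ => p) (n := c) (by simpa using hcol)
    refine ⟨fun _ => p, {n | n ∈ F ∧ d n = j + 1 ∧ G.Adj n p}, _,
      ⟨fun e e' h => absurd (Subsingleton.elim e e') h, fun n hn _ => hn.2.2, ?_, ?_⟩,
      fun _ => hFS hp.1, fun n hn => hFS hn.1, fun u hu => hFS hu.1.1.1, h3⟩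
    · rintro u ⟨⟨-, n, hn, hnu, hnp⟩, -⟩
      exact ⟨n, ⟨hn.1, hn.2, hnp⟩, hnu⟩
    · rintro - u ⟨-, h⟩
      exact h () (by simp)

/-- One can pass to a hard part of `C` on which the vertices of `N` either avoid some vertex
of `Y`, or are complete to `Y` as soon as they have a neighbour in the part. -/
theorem exists_uniform_part (Y : Finset V) {C N : Set V} {M : ℕ}
    (hcov : ∀ u ∈ C, ∃ n ∈ N, G.Adj n u) (hC : ¬ Col G C (M * (Y.card + 1))) :
    ∃ C' ⊆ C, ∃ N' ⊆ N, (∀ u ∈ C', ∃ n ∈ N', G.Adj n u) ∧ ¬ Col G C' M ∧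
      ((∃ v ∈ Y, ∀ n ∈ N', ¬ G.Adj n v) ∨
        ∀ n ∈ N, (∃ u ∈ C', G.Adj n u) → ∀ v ∈ Y, G.Adj n v) := by
  by_cases h : ∀ v ∈ Y, Col G {u ∈ C | ∃ n ∈ N, G.Adj n u ∧ ¬ G.Adj n v} M
  · refine ⟨_, Set.sep_subset _ _, N, subset_rfl, fun u hu => hcov u hu.1,
      not_col_diff Y _ (fun h' => hC (h'.mono subset_rfl (by rw [Nat.mul_succ]; lia))) h,
      .inr ?_⟩
    rintro n hn ⟨u, hu, hnu⟩ v hv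
    by_contra hnv
    exact hu.2 v hv ⟨hu.1, n, hn, hnu, hnv⟩
  · push Not at h
    obtain ⟨v, hv, hcol⟩ := h
    refine ⟨_, Set.sep_subset _ _, {n ∈ N | ¬ G.Adj n v}, Set.sep_subset _ _, ?_, hcol,
      .inl ⟨v, hv, fun n hn => hn.2⟩⟩
    rintro u ⟨-, n, hn, hnu, hnv⟩
    exact ⟨n, ⟨hn, hnv⟩, hnu⟩

theorem exists_uniform_parts (Y : Finset V) (m : ℕ) : ∀ {C : Set V} {N : ℕ → Set V} {M : ℕ},
    (∀ i < m, ∀ u ∈ C, ∃ n ∈ N i, G.Adj n u) → ¬ Col G C (M * (Y.card + 1) ^ m) →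
    ∃ C' ⊆ C, ∃ N' : ℕ → Set V, (∀ i, N' i ⊆ N i) ∧ (∀ i, m ≤ i → N' i = N i) ∧
      (∀ i < m, ∀ u ∈ C', ∃ n ∈ N' i, G.Adj n u) ∧ ¬ Col G C' M ∧
      ∀ i < m, (∃ v ∈ Y, ∀ n ∈ N' i, ¬ G.Adj n v) ∨
        ∀ n ∈ N i, (∃ u ∈ C', G.Adj n u) → ∀ v ∈ Y, G.Adj n v := by
  classical
  induction m with
  | zero =>
    intro C N M _ hC
    exact ⟨C, subset_rfl, N, fun _ => subset_rfl, fun _ _ => rfl, by simp, by simpa using hC,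
      by simp⟩
  | succ m ih =>
    intro C N M hcov hC
    obtain ⟨C₁, hC₁, N₁, hN₁, hN₁', hcov₁, hcol₁, h₁⟩ := ih (M := M * (Y.card + 1))
      (fun i hi => hcov i (by omega)) (by rwa [mul_assoc, ← pow_succ'])
    obtain ⟨C', hC', N', hN', hcov', hcol', h'⟩ := exists_uniform_part Y
      (N := N m) (fun u hu => hcov m (by omega) u (hC₁ hu)) hcol₁
    refine ⟨C', hC'.trans hC₁, fun i => if i = m then N' else N₁ i, ?_, ?_, ?_, hcol', ?_⟩
    · intro i
      dsimp only
      split_ifs with h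
      · exact h ▸ hN'
      · exact hN₁ i
    · intro i hi
      dsimp only
      rw [if_neg (by omega)]
      exact hN₁' i (by omega)
    · intro i hi
      dsimp only
      split_ifs with h
      · exact hcov'
      · exact fun u hu => hcov₁ i (by omega) u (hC' hu)
    · intro i hi
      dsimp only
      split_ifs with h
      · exact h ▸ h'
      · refine (h₁ i (by omega)).imp_right fun h2 n hn hu => h2 n hn ?_
        exact hu.imp fun u hu => ⟨hC' hu.1, hu.2⟩

theorem exists_uniform_list (j : ℕ) (l : List (ℕ × V)) : ∀ {C : Set V} {N : ℕ → Set V} {M : ℕ},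
    (∀ p ∈ l, p.1 ≤ j) → (∀ i ≤ j, ∀ u ∈ C, ∃ n ∈ N i, G.Adj n u) →
    ¬ Col G C (M * 2 ^ (j * l.length)) →
    ∃ C' ⊆ C, ∃ N' : ℕ → Set V, (∀ i, N' i ⊆ N i) ∧
      (∀ i ≤ j, ∀ u ∈ C', ∃ n ∈ N' i, G.Adj n u) ∧ ¬ Col G C' M ∧
      ∀ p ∈ l, ∀ i < p.1, (∀ n ∈ N' i, ¬ G.Adj n p.2) ∨
        ∀ n ∈ N' i, (∃ u ∈ C', G.Adj n u) → G.Adj n p.2 := by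
  classical
  induction l with
  | nil =>
    intro C N M _ hcov hC
    exact ⟨C, subset_rfl, N, fun _ => subset_rfl, hcov, by simpa using hC, by simp⟩
  | cons p l ih =>
    intro C N M hl hcov hC
    obtain ⟨C₁, hC₁, N₁, hN₁, hcov₁, hcol₁, h₁⟩ := ih (M := M * 2 ^ j)
      (fun q hq => hl q (by simp [hq])) hcov
      (by rwa [mul_assoc, ← pow_add, Nat.add_comm, ← Nat.mul_succ])
    have hpj : p.1 ≤ j := hl p (by simp)
    obtain ⟨C', hC', N', hN', hN'', hcov', hcol', h'⟩ := exists_uniform_parts {p.2} p.1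
      (C := C₁) (N := N₁) (M := M) (fun i hi => hcov₁ i (by omega)) (fun h =>
        hcol₁ (h.mono subset_rfl (Nat.mul_le_mul_left _ (by
          rw [Finset.card_singleton]; exact Nat.pow_le_pow_right (by omega) hpj))))
    refine ⟨C', hC'.trans hC₁, N', fun i => (hN' i).trans (hN₁ i), ?_, hcol', ?_⟩
    · intro i hi
      rcases lt_or_ge i p.1 with h | h
      · exact hcov' i h
      · rw [hN'' i h]
        exact fun u hu => hcov₁ i hi u (hC' hu)
    · intro q hq i hi
      rcases List.mem_cons.1 hq with rfl | hq
      · rcases h' i hi with ⟨v, hv, h2⟩ | h2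
        · rw [Finset.mem_singleton] at hv
          exact .inl (hv ▸ h2)
        · exact .inr fun n hn hu => h2 n (hN' i hn) hu _ (by simp)
      · refine (h₁ q hq i hi).imp (fun h2 n hn => h2 n (hN' i hn)) fun h2 n hn hu =>
          h2 n (hN' i hn) ?_
        exact hu.imp fun u hu => ⟨hC' hu.1, hu.2⟩

/-- The invariant of the construction: `N i`, for `i < j`, covers `C` and is complete to a vertex
anticomplete to `C`. -/
structure Stage (G : SimpleGraph V) (S : Set V) (j : ℕ) (C : Set V) (N : ℕ → Set V) : Prop where
  sub : C ⊆ S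
  subN : ∀ i < j, N i ⊆ S
  cover : ∀ i < j, ∀ u ∈ C, ∃ n ∈ N i, G.Adj n u
  root : ∀ i < j, ∃ x, (∀ n ∈ N i, G.Adj x n) ∧ ∀ u ∈ C, x ≠ u ∧ ¬ G.Adj x u

/-- One step of the construction: a clique `X` is picked in `C`, together with a new covering set
`N' j` and vertices `w h e` of `N h` adjacent to `X e`. -/
structure Step (G : SimpleGraph V) {k : ℕ} (j : ℕ) (C : Set V) (N : ℕ → Set V) (X : Fin k → V)
    (w : ℕ → Fin k → V) (C' : Set V) (N' : ℕ → Set V) : Prop where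
  sub : C' ⊆ C
  subN : ∀ i < j, N' i ⊆ N i
  new : N' j ⊆ C
  cover : ∀ i ≤ j, ∀ u ∈ C', ∃ n ∈ N' i, G.Adj n u
  mem : ∀ e, X e ∈ C
  clique : ∀ e e', e ≠ e' → G.Adj (X e) (X e')
  complete : ∀ n ∈ N' j, ∀ e, G.Adj n (X e)
  anti : ∀ e, ∀ u ∈ C', X e ≠ u ∧ ¬ G.Adj (X e) u
  mem_w : ∀ h < j, ∀ e, w h e ∈ N h
  adj_w : ∀ h < j, ∀ e, G.Adj (w h e) (X e)
  anti_w : ∀ h < j, ∀ e, ∀ u ∈ C', ¬ G.Adj (w h e) u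
  uniform : ∀ i < j, (∃ e, ∀ n ∈ N' i, ¬ G.Adj n (X e)) ∨
    ∀ n ∈ N i, (∃ u ∈ C', G.Adj n u) → ∀ e, G.Adj n (X e)
  uniform_w : ∀ h < j, ∀ i < h, ∀ e, (∀ n ∈ N' i, ¬ G.Adj n (w h e)) ∨
    ∀ n ∈ N' i, (∃ u ∈ C', G.Adj n u) → G.Adj n (w h e)
  link : ∀ i < j, ∀ y ∈ N' j, ∃ n ∈ N i, G.Adj n y ∧ ∃ e, ¬ G.Adj n (X e)

theorem Step.stage {S : Set V} {k j : ℕ} {C C' : Set V} {N N' : ℕ → Set V} {X : Fin k → V}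
    {w : ℕ → Fin k → V} (hk : 0 < k) (hs : Stage G S j C N) (h : Step G j C N X w C' N') :
    Stage G S (j + 1) C' N' := by
  refine ⟨h.sub.trans hs.sub, fun i hi => ?_, fun i hi => h.cover i (by omega), fun i hi => ?_⟩
  · rcases Nat.lt_succ_iff_lt_or_eq.1 hi with hi | rfl
    · exact (h.subN i hi).trans (hs.subN i hi)
    · exact h.new.trans hs.sub
  · rcases Nat.lt_succ_iff_lt_or_eq.1 hi with hi | rfl
    · obtain ⟨x, h1, h2⟩ := hs.root i hi
      exact ⟨x, fun n hn => h1 n (h.subN i hi hn), fun u hu => h2 u (h.sub hu)⟩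
    · exact ⟨X ⟨0, hk⟩, fun n hn => (h.complete n hn _).symm, h.anti _⟩

/-- The set `S` contains no `(k + 1)`-pair that is hard. -/
def NoPair (G : SimpleGraph V) (S : Set V) (k c : ℕ) : Prop :=
  ∀ (X : Fin (k + 1) → V) (N C : Set V), KPair G X N C → (∀ e, X e ∈ S) → N ⊆ S → C ⊆ S →
    Col G C c

/-- Without hard `(k + 1)`-pairs, a vertex complete to a `k`-clique is close to an easy set only,
through vertices complete to that clique. -/
theorem NoPair.col_close {ℓ τ K k c : ℕ} (hG : Tame ℓ τ K G) {S : Set V}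
    (hS : NoPair G S k c) {X : Fin k → V} (hX : ∀ e e', e ≠ e' → G.Adj (X e) (X e'))
    (hXS : ∀ e, X e ∈ S) {y : V} (hy : y ∈ S) (hyX : ∀ e, G.Adj y (X e)) {N C : Set V}
    (hN : N ⊆ S) (hC : C ⊆ S)
    (hNX : ∀ n ∈ N, (∃ u ∈ C, G.Adj n u) → G.Adj n y → ∀ e, G.Adj n (X e)) :
    Col G {u ∈ C | ∃ n ∈ N, G.Adj n u ∧ G.Adj n y} (c + (k + 1) * (τ + 1)) := by
  classical
  by_contra hcol
  have h1 := not_col_sdiff_nbrs hG.nbr (Finset.univ : Finset (Fin (k + 1)))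
    (Fin.cons y X : Fin (k + 1) → V) (n := c) (by simpa using hcol)
  refine h1 (hS (Fin.cons y X) {n ∈ N | (∃ u ∈ C, G.Adj n u) ∧ G.Adj n y} _ ⟨?_, ?_, ?_, ?_⟩ ?_
    (fun n hn => hN hn.1) fun u hu => hC hu.1.1)
  · intro e e' hne
    cases e using Fin.cases with
    | zero =>
      cases e' using Fin.cases with
      | zero => exact absurd rfl hne
      | succ e' => simpa using hyX e'
    | succ e =>
      cases e' using Fin.cases with
      | zero => simpa using (hyX e).symm
      | succ e' => simpa using hX e e' fun h => hne (h ▸ rfl)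
  · rintro n ⟨hn, hu, hny⟩ e
    cases e using Fin.cases with
    | zero => simpa using hny
    | succ e => simpa using hNX n hn hu hny e
  · rintro u ⟨⟨hu, n, hn, hnu, hny⟩, -⟩
    exact ⟨n, ⟨hn, ⟨u, hu, hnu⟩, hny⟩, hnu⟩
  · rintro e u ⟨-, h⟩
    exact h e (Finset.mem_univ _)
  · intro e
    cases e using Fin.cases with
    | zero => simpa using hy
    | succ e => simpa using hXS e

theorem exists_step {ℓ τ K k : ℕ} (hP : HasPairs ℓ τ K k) (c j M' : ℕ) :
    ∃ M, ∀ (V : Type) (G : SimpleGraph V), Tame ℓ τ K G → ∀ S, NoPair G S k c →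
      ∀ C N, Stage G S j C N → ¬ Col G C M →
      ∃ (C' : Set V) (N' : ℕ → Set V) (X : Fin k → V) (w : ℕ → Fin k → V),
        Step G j C N X w C' N' ∧ ¬ Col G C' M' := by
  classical
  set c₁ := c + (k + 1) * (τ + 1) with hc₁
  set M₂ := M' * 2 ^ (j * (j * k)) with hM₂
  set M₃ := M₂ * (k + 1) ^ j with hM₃
  obtain ⟨M₁, hM₁⟩ := hP (M₃ + (j * k) * (τ + 1))
  refine ⟨M₁ + j * ((ℓ + 2) * (τ + c₁)), fun V G hG S hS C N hst hC => ?_⟩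
  have hclean := not_col_diff (Finset.range j)
    (fun i => {y ∈ C | Col G {u ∈ C | ∃ n ∈ N i, G.Adj n u ∧ G.Adj n y} c₁})
    (by rw [Finset.card_range]; exact hC) (fun i hi => by
      have hi' := Finset.mem_range.1 hi
      obtain ⟨x, hxN, hxC⟩ := hst.root i hi'
      refine hG.col_of_levelling (U := {x}) (N := N i) (Conn.singleton x) ?_ ?_ ?_ ?_ ?_ ?_
      · rintro _ rfl v hv
        exact hxC v hv.1
      · rintro n hn rfl
        exact G.irrefl (hxN _ hn)
      · intro n hn hn'
        exact (hxC n hn'.1).2 (hxN n hn)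
      · exact fun n hn => ⟨x, rfl, (hxN n hn).symm⟩
      · exact fun u hu => hst.cover i hi' u hu.1
      · rintro p ⟨-, hp⟩
        refine Col.mono ?_ le_rfl hp
        exact fun u hu => ⟨hu.1.1, hu.2⟩)
  obtain ⟨X, Nj, D, hpair, hXC, hNC, hDC, hD⟩ := hM₁ V G hG _ hclean
  have hclose : ∀ y ∈ Nj, ∀ i < j, ∃ n ∈ N i, G.Adj n y ∧ ∃ e, ¬ G.Adj n (X e) := by
    intro y hy i hi
    by_contra! hcon
    refine (hNC hy).2 i (Finset.mem_range.2 hi) ⟨(hNC hy).1, ?_⟩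
    exact hS.col_close hG hpair.clique (fun e => hst.sub (hXC e).1) (hst.sub (hNC hy).1)
      (hpair.complete y hy) (hst.subN i hi) hst.sub fun n hn _ hny => hcon n hn hny
  have hw : ∀ h e, ∃ x, h < j → x ∈ N h ∧ G.Adj x (X e) := by
    intro h e
    by_cases hh : h < j
    · obtain ⟨x, hx, hxe⟩ := hst.cover h hh _ (hXC e).1
      exact ⟨x, fun _ => ⟨hx, hxe⟩⟩
    · exact ⟨X e, fun h' => absurd h' hh⟩
  choose w hw using hw
  have hD' := not_col_sdiff_nbrs hG.nbr (Finset.range j ×ˢ (Finset.univ : Finset (Fin k)))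
    (fun p => w p.1 p.2) (n := M₃) (S := D) (by simpa using hD)
  have hcardY : (Finset.univ.image X).card ≤ k := by
    simpa using Finset.card_image_le (s := Finset.univ) (f := X)
  obtain ⟨D₁, hD₁, N₁, hN₁, hN₁', hcov₁, hcol₁, huni₁⟩ := exists_uniform_parts
    (Finset.univ.image X) j (N := fun i => if i = j then Nj else N i) (M := M₂)
    (fun i hi u hu => by
      rw [if_neg (by omega)]
      exact hst.cover i hi u (hDC hu.1).1)
    (fun h => hD' (h.mono subset_rfl (Nat.mul_le_mul_left _
      (Nat.pow_le_pow_left (by omega) j))))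
  have hcov₁' : ∀ i ≤ j, ∀ u ∈ D₁, ∃ n ∈ N₁ i, G.Adj n u := by
    intro i hi u hu
    rcases Nat.lt_or_eq_of_le hi with hi | rfl
    · exact hcov₁ i hi u hu
    · rw [hN₁' i le_rfl, if_pos rfl]
      exact hpair.cover u (hD₁ hu).1
  set l : List (ℕ × V) :=
    (List.range j ×ˢ List.finRange k).map fun p => (p.1, w p.1 p.2) with hl
  have hmem : ∀ h < j, ∀ e, (h, w h e) ∈ l := fun h hh e =>
    List.mem_map.2 ⟨(h, e), List.mem_product.2 ⟨by simpa using hh, by simp⟩, rfl⟩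
  obtain ⟨C', hC', N', hN', hcov', hcol', huni'⟩ := exists_uniform_list j l (M := M')
    (by
      intro p hp
      obtain ⟨⟨h, e⟩, hq, rfl⟩ := List.mem_map.1 hp
      have : h < j := by simpa using (List.mem_product.1 hq).1
      exact this.le) hcov₁' (by
      have : l.length = j * k := by simp [hl, List.length_product]
      rwa [this])
  have hsubN : ∀ i < j, N₁ i ⊆ N i := fun i hi => by
    have := hN₁ i
    rwa [if_neg (by omega)] at this
  have hsubj : N' j ⊆ Nj := (hN' j).trans (by rw [hN₁' j le_rfl, if_pos rfl])
  have hC'D : C' ⊆ D := fun u hu => (hD₁ (hC' hu)).1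
  refine ⟨C', N', X, w, ⟨fun u hu => (hDC (hC'D hu)).1, fun i hi => (hN' i).trans (hsubN i hi),
    fun n hn => (hNC (hsubj hn)).1, hcov', fun e => (hXC e).1, hpair.clique,
    fun n hn => hpair.complete n (hsubj hn), fun e u hu => hpair.anti e u (hC'D hu),
    fun h hh e => (hw h e hh).1, fun h hh e => (hw h e hh).2, ?_, ?_, ?_, ?_⟩, hcol'⟩
  · intro h hh e u hu
    exact ((hD₁ (hC' hu)).2 (h, e) (by simpa using hh)).2
  · intro i hi
    rcases huni₁ i hi with ⟨v, hv, h⟩ | h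
    · obtain ⟨e, -, rfl⟩ := Finset.mem_image.1 hv
      exact .inl ⟨e, fun n hn => h n (hN' i hn)⟩
    · rw [if_neg (by omega)] at h
      exact .inr fun n hn hu e => h n hn (hu.imp fun u hu => ⟨hC' hu.1, hu.2⟩) _ (by simp)
  · exact fun h hh i hi e => huni' _ (hmem h hh e) i hi
  · exact fun i hi y hy => hclose y (hsubj hy) i hi

/-- The sequence of stages obtained by iterating the construction. -/
structure Tower {V : Type*} (G : SimpleGraph V) (S : Set V) {k : ℕ} (t : ℕ) (C : ℕ → Set V)
    (N : ℕ → ℕ → Set V) (X : ℕ → Fin k → V) (w : ℕ → ℕ → Fin k → V) : Prop where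
  stage : ∀ j ≤ t, Stage G S j (C j) (N j)
  step : ∀ j < t, Step G j (C j) (N j) (X j) (w j) (C (j + 1)) (N (j + 1))

theorem exists_tower {ℓ τ K k : ℕ} (hk : 0 < k) (hP : HasPairs ℓ τ K k) (c t : ℕ) :
    ∀ M', ∃ M, ∀ (V : Type) (G : SimpleGraph V), Tame ℓ τ K G → ∀ S, NoPair G S k c →
      ¬ Col G S M → ∃ (C : ℕ → Set V) (N : ℕ → ℕ → Set V) (X : ℕ → Fin k → V)
        (w : ℕ → ℕ → Fin k → V), Tower G S t C N X w ∧ ¬ Col G (C t) M' := by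
  classical
  induction t with
  | zero =>
    intro M'
    refine ⟨M', fun V G hG S hS hcol => ?_⟩
    obtain ⟨v, -⟩ := nonempty_of_not_col hcol
    refine ⟨fun _ => S, fun _ _ => ∅, fun _ _ => v, fun _ _ _ => v, ⟨fun j hj => ?_, by simp⟩,
      hcol⟩
    obtain rfl : j = 0 := by omega
    exact ⟨subset_rfl, by simp, by simp, by simp⟩
  | succ t ih =>
    intro M'
    obtain ⟨M₁, hM₁⟩ := exists_step hP c t M'
    obtain ⟨M, hM⟩ := ih M₁
    refine ⟨M, fun V G hG S hS hcol => ?_⟩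
    obtain ⟨C, N, X, w, hT, hcol₁⟩ := hM V G hG S hS hcol
    obtain ⟨C', N', X', w', hstep, hcol'⟩ := hM₁ V G hG S hS _ _ (hT.stage t le_rfl) hcol₁
    refine ⟨fun j => if j = t + 1 then C' else C j, fun j => if j = t + 1 then N' else N j,
      fun j => if j = t then X' else X j, fun j => if j = t then w' else w j,
      ⟨fun j hj => ?_, fun j hj => ?_⟩, by simpa using hcol'⟩
    · split_ifs with h
      · subst h
        exact hstep.stage hk (hT.stage t le_rfl)
      · exact hT.stage j (by omega)
    · have h1 : j ≠ t + 1 := by omega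
      by_cases h2 : j = t
      · subst h2
        simpa using hstep
      · simpa [h1, h2] using hT.step j (by omega)

theorem exists_inducedCycle_of_seq {r : ℕ} (hr : 2 ≤ r) (y : ℕ → V) {x n v : V}
    (hy : ∀ a < r, G.Adj (y a) (y (a + 1))) (hy' : ∀ a b, a + 1 < b → b ≤ r → ¬ G.Adj (y a) (y b))
    (hx : G.Adj x (y 0)) (hx' : ∀ a, 1 ≤ a → a ≤ r → x ≠ y a ∧ ¬ G.Adj x (y a))
    (hv : G.Adj v (y r)) (hv' : ∀ a < r, v ≠ y a ∧ ¬ G.Adj v (y a))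
    (hnx : G.Adj n x) (hnv : G.Adj n v) (hn : ∀ a, 1 ≤ a → a ≤ r → ¬ G.Adj n (y a)) :
    ∃ l, r + 2 ≤ l ∧ InducedCycle G l := by
  refine exists_inducedCycle (S := {u | ∃ a ≤ r, y a = u}) (T := {x, n, v}) (a := y 0) (b := y r)
    (a' := x) (b' := v) hr (fun u a => a ≤ r ∧ y a = u) ⟨0, by omega, rfl⟩
    (Joined.of_seq y r (fun i hi => ⟨i, hi, rfl⟩) hy) ⟨by omega, rfl⟩ ?_ ?_ (by simp) (by simp)
    ((Joined.of_adj hnx.symm (by simp) (by simp)).trans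
      (Joined.of_adj hnv (by simp) (by simp))) hx.symm hv.symm ?_ ?_
  · rintro _ ⟨a, ha, rfl⟩ _ ⟨b, hb, rfl⟩ hab c ⟨hc, hca⟩
    refine ⟨b, ?_, hb, rfl⟩
    by_contra hlt
    rw [← hca] at hab
    exact hy' c b (by omega) hb hab
  · rintro a ⟨ha, har⟩
    by_contra hlt
    exact (hv' a (by omega)).2 (har ▸ hv)
  · rintro _ ⟨a, ha, rfl⟩ (h | h | h)
    · rcases Nat.eq_zero_or_pos a with rfl | h0
      · exact hx.ne h.symm
      · exact (hx' a h0 ha).1 h.symm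
    · rcases Nat.eq_zero_or_pos a with rfl | h0
      · exact (hv' 0 (by omega)).2 (h ▸ hnv.symm)
      · exact (hx' a h0 ha).2 (h ▸ hnx.symm)
    · rw [Set.mem_singleton_iff] at h
      rcases Nat.lt_or_eq_of_le ha with ha | rfl
      · exact (hv' a ha).1 h.symm
      · exact hv.ne h.symm
  · rintro _ ⟨a, ha, rfl⟩ u hu hau
    by_contra! hne
    have h0 : 1 ≤ a := by
      rcases Nat.eq_zero_or_pos a with rfl | h0
      · exact absurd rfl hne.1
      · exact h0
    have h1 : a < r := lt_of_le_of_ne ha fun h => hne.2 (h ▸ rfl)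
    rcases hu with rfl | rfl | hu
    · exact (hx' a h0 ha).2 hau.symm
    · exact hn a h0 ha hau.symm
    · rw [Set.mem_singleton_iff] at hu
      exact (hv' a h1).2 (hu ▸ hau.symm)

theorem exists_inducedCycle_of_ladder {m : ℕ} (hm : 3 ≤ m) (x z : ℕ → V) {z' : V}
    (hxx : ∀ a b, a < b → b ≤ m → x a ≠ x b ∧ ¬ G.Adj (x a) (x b))
    (hxz : ∀ a b, a < b → b < m → x a ≠ z b ∧ ¬ G.Adj (x a) (z b))
    (hzx : ∀ a b, a + 1 < b → b ≤ m → ¬ G.Adj (z a) (x b))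
    (hzz : ∀ a b, a + 1 < b → b < m → ¬ G.Adj (z a) (z b))
    (h1 : ∀ a < m, G.Adj (z a) (x a)) (h2 : ∀ a < m, G.Adj (z a) (x (a + 1)))
    (h0 : G.Adj z' (x 0)) (hm' : G.Adj z' (x m)) (hx : ∀ a, 1 ≤ a → a < m → ¬ G.Adj z' (x a))
    (hz : ∀ a, 1 ≤ a → a + 1 < m → ¬ G.Adj z' (z a)) :
    ∃ l, m + 1 ≤ l ∧ InducedCycle G l := by
  have hlast : G.Adj (z (m - 1)) (x m) := by
    have := h2 (m - 1) (by omega)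
    rwa [show m - 1 + 1 = m by omega] at this
  have hzm : ∀ a < m, G.Adj (z a) (x m) → a = m - 1 := by
    intro a ha h
    by_contra hne
    exact hzx a m (by omega) le_rfl h
  have hjoin : ∀ a < m, Joined G {v | ∃ a < m, v = z a ∨ (1 ≤ a ∧ v = x a)} (z 0) (z a) := by
    intro a
    induction a with
    | zero => exact fun _ => .refl
    | succ a ih =>
      intro ha
      have hx : x (a + 1) ∈ {v | ∃ a < m, v = z a ∨ (1 ≤ a ∧ v = x a)} :=
        ⟨a + 1, ha, .inr ⟨by omega, rfl⟩⟩
      exact ((ih (by omega)).tail ⟨h2 a (by omega), ⟨a, by omega, .inl rfl⟩, hx⟩).tail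
        ⟨(h1 _ ha).symm, hx, ⟨a + 1, ha, .inl rfl⟩⟩
  obtain ⟨l, hl, hl'⟩ := exists_inducedCycle
    (S := {v | ∃ a < m, v = z a ∨ (1 ≤ a ∧ v = x a)}) (T := {x 0, z', x m})
    (a := z 0) (b := z (m - 1)) (a' := x 0) (b' := x m) (L := m - 1) (G := G) (by omega)
    (fun v a => a < m ∧ (v = z a ∨ (1 ≤ a ∧ v = x a))) ⟨0, by omega, .inl rfl⟩
    (hjoin _ (by omega)) ⟨by omega, .inl rfl⟩ (by
      rintro u - v ⟨b, hb, hvb⟩ huv a ⟨ha, hua⟩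
      refine ⟨b, ?_, hb, hvb⟩
      by_contra hlt
      rcases hua with rfl | ⟨-, rfl⟩ <;> rcases hvb with rfl | ⟨-, rfl⟩
      · exact hzz a b (by omega) hb huv
      · exact hzx a b (by omega) hb.le huv
      · exact (hxz a b (by omega) hb).2 huv
      · exact (hxx a b (by omega) hb.le).2 huv) (by
      rintro a ⟨ha, h | ⟨-, h⟩⟩
      · exact (hzm a ha (h ▸ hlast)).ge
      · exact absurd (h ▸ hlast) (hxx a m ha le_rfl).2) (by simp) (by simp)
    ((Joined.of_adj h0.symm (by simp) (by simp)).trans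
      (Joined.of_adj hm' (by simp) (by simp))) (h1 0 (by omega)) hlast (by
      rintro _ ⟨a, ha, rfl | ⟨ha0, rfl⟩⟩ (h | h | h)
      · rcases Nat.eq_zero_or_pos a with rfl | ha0
        · exact (h1 0 ha).ne h
        · exact (hxz 0 a ha0 ha).1 h.symm
      · rcases Nat.eq_zero_or_pos a with rfl | ha0
        · exact hzx 0 m (by omega) le_rfl (h ▸ hm')
        · exact (hxz 0 a ha0 ha).2 (h ▸ h0.symm)
      · rw [Set.mem_singleton_iff] at h
        exact (hxx a m ha le_rfl).2 (h ▸ (h1 a ha).symm)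
      · exact (hxx 0 a ha0 ha.le).1 h.symm
      · exact (hxx 0 a ha0 ha.le).2 (h ▸ h0.symm)
      · rw [Set.mem_singleton_iff] at h
        exact (hxx a m ha le_rfl).1 h) (by
      rintro _ ⟨a, ha, rfl | ⟨ha0, rfl⟩⟩ u hu hau
      · by_contra! hne
        have ha0 : 1 ≤ a := by
          rcases Nat.eq_zero_or_pos a with rfl | h0
          · exact absurd rfl hne.1
          · exact h0
        have ham : a + 1 < m := by
          by_contra h
          exact hne.2 (by rw [show a = m - 1 by omega])
        rcases hu with rfl | rfl | hu
        · exact (hxz 0 a ha0 ha).2 hau.symm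
        · exact hz a ha0 ham hau.symm
        · rw [Set.mem_singleton_iff] at hu
          exact hzx a m ham le_rfl (hu ▸ hau)
      · exfalso
        rcases hu with rfl | rfl | hu
        · exact (hxx 0 a ha0 ha.le).2 hau.symm
        · exact hx a ha0 ha hau.symm
        · rw [Set.mem_singleton_iff] at hu
          exact (hxx a m ha le_rfl).2 (hu ▸ hau))
  exact ⟨l, by omega, hl'⟩

section Towers

variable {S : Set V} {k t : ℕ} {C : ℕ → Set V}
  {N : ℕ → ℕ → Set V} {X : ℕ → Fin k → V} {w : ℕ → ℕ → Fin k → V}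

theorem Tower.C_anti (h : Tower G S t C N X w) {i j : ℕ} (hij : i ≤ j) (hj : j ≤ t) :
    C j ⊆ C i := by
  induction j, hij using Nat.le_induction with
  | base => exact subset_rfl
  | succ j hij ih => exact (h.step j (by omega)).sub.trans (ih (by omega))

theorem Tower.N_anti (h : Tower G S t C N X w) {l i j : ℕ} (hl : l < i) (hij : i ≤ j)
    (hj : j ≤ t) : N j l ⊆ N i l := by
  induction j, hij using Nat.le_induction with
  | base => exact subset_rfl
  | succ j hij ih =>
    exact ((h.step j (by omega)).subN l (by omega)).trans (ih (by omega))

theorem Tower.X_mem (h : Tower G S t C N X w) {i j : ℕ} (hij : i ≤ j) (hj : j < t)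
    (e : Fin k) : X j e ∈ C i :=
  h.C_anti hij hj.le ((h.step j hj).mem e)

theorem Tower.N_mem (h : Tower G S t C N X w) {i l j : ℕ} (hil : i ≤ l) (hlj : l < j)
    (hj : j ≤ t) {n : V} (hn : n ∈ N j l) : n ∈ C i :=
  h.C_anti hil (by omega) ((h.step l (by omega)).new (h.N_anti (Nat.lt_succ_self l) hlj hj hn))

theorem Tower.N_adj (h : Tower G S t C N X w) {l j : ℕ} (hlj : l < j) (hj : j ≤ t) {n : V}
    (hn : n ∈ N j l) (e : Fin k) : G.Adj n (X l e) :=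
  (h.step l (by omega)).complete n (h.N_anti (Nat.lt_succ_self l) hlj hj hn) e

/-- If the vertices of each `N i` are complete to the later vertices `w j h e`, there is a large
clique. -/
theorem Tower.false_of_complete {ℓ τ K : ℕ} (hG : Tame ℓ τ K G) (h : Tower G S t C N X w)
    {g : ℕ → ℕ} (hg : ∀ a b, a < b → b < 2 * (K + 1) → g a < g b)
    (hgt : ∀ a < 2 * (K + 1), g a < t) (e : Fin k)
    (hw : ∀ a b c, a < b → b < c → c < 2 * (K + 1) →
      ∃ n ∈ N (g c + 1) (g a), G.Adj n (w (g c) (g b) e)) : False := by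
  refine hG.no_clique (fun a => w (g (2 * K + 1 - a)) (g a) e) fun a b hab => ?_
  have hab' : (a : ℕ) < b := hab
  have hb := b.2
  have g1 := hg a b hab' (by omega)
  have g2 := hg b (2 * K + 1 - b) (by omega) (by omega)
  have g3 := hg (2 * K + 1 - b) (2 * K + 1 - a) (by omega) (by omega)
  have g4 := hgt (2 * K + 1 - a) (by omega)
  have hsa := h.step _ g4
  have hsb := h.step _ (g3.trans g4)
  rcases hsb.uniform_w (g b) g2 (g a) g1 e with h1 | h1
  · obtain ⟨n, hn, hn'⟩ := hw a b (2 * K + 1 - b) hab' (by omega) (by omega)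
    exact absurd hn' (h1 n hn)
  · exact h1 _ (h.N_anti (by omega) g3 g4.le (hsa.mem_w (g a) (by omega) e))
      ⟨X (g (2 * K + 1 - a)) e, h.X_mem g3 g4 e, hsa.adj_w (g a) (by omega) e⟩

/-- If the vertices of each `N i` avoid the later vertices `w j h e` and `X j e`, there is a long
hole. -/
theorem Tower.exists_inducedCycle_of_anti {m : ℕ} (hm : 3 ≤ m) (h : Tower G S t C N X w)
    {g : ℕ → ℕ} (hg : ∀ a b, a < b → b ≤ m → g a < g b) (hgt : ∀ a ≤ m, g a < t) (e : Fin k)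
    (hX : ∀ a b, a < b → b < m → ∀ n ∈ N (g b + 1) (g a), ¬ G.Adj n (X (g b) e))
    (hw : ∀ a b c, a < b → b < c → c < m →
      ∀ n ∈ N (g c + 1) (g a), ¬ G.Adj n (w (g c) (g b) e)) :
    ∃ l, m + 1 ≤ l ∧ InducedCycle G l := by
  have hstep := fun a (ha : a ≤ m) => h.step (g a) (hgt a ha)
  have hz : ∀ a < m, w (g (a + 1)) (g a) e ∈ N (g (a + 1)) (g a) := fun a ha =>
    (hstep (a + 1) ha).mem_w (g a) (hg a (a + 1) (by omega) ha) e
  have hzC : ∀ a b, a < b → b < m → w (g (b + 1)) (g b) e ∈ C (g a + 1) := fun a b hab hb =>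
    h.N_mem (hg a b hab hb.le) (hg b (b + 1) (by omega) hb) (hgt _ hb).le (hz b hb)
  have hxC : ∀ a b, a < b → b ≤ m → X (g b) e ∈ C (g a + 1) := fun a b hab hb =>
    h.X_mem (hg a b hab hb) (hgt b hb) e
  have g0m := hg 0 m (by omega) le_rfl
  have hz' : w (g m) (g 0) e ∈ N (g m) (g 0) := (hstep m le_rfl).mem_w (g 0) g0m e
  refine exists_inducedCycle_of_ladder hm (fun a => X (g a) e) (fun a => w (g (a + 1)) (g a) e)
    (z' := w (g m) (g 0) e) ?_ ?_ ?_ ?_ ?_ ?_ ?_ ?_ ?_ ?_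
  · exact fun a b hab hb => (hstep a (by omega)).anti e _ (hxC a b hab hb)
  · exact fun a b hab hb => (hstep a (by omega)).anti e _ (hzC a b hab hb)
  · exact fun a b hab hb => (hstep (a + 1) (by omega)).anti_w (g a)
      (hg _ _ (by omega) (by omega)) e _ (hxC (a + 1) b hab hb)
  · exact fun a b hab hb => (hstep (a + 1) (by omega)).anti_w (g a)
      (hg _ _ (by omega) (by omega)) e _ (hzC (a + 1) b hab hb)
  · exact fun a ha => h.N_adj (hg _ _ (by omega) ha) (hgt _ ha).le (hz a ha) e
  · exact fun a ha => (hstep (a + 1) ha).adj_w (g a) (hg _ _ (by omega) ha) e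
  · exact h.N_adj g0m (hgt m le_rfl).le hz' e
  · exact (hstep m le_rfl).adj_w (g 0) g0m e
  · intro a ha ham
    have g1 := hg 0 a ha ham.le
    exact hX 0 a ha ham _ (h.N_anti (by omega) (hg a m ham le_rfl) (hgt m le_rfl).le hz')
  · intro a ha ham
    have g1 := hg 0 (a + 1) (by omega) ham.le
    exact hw 0 a (a + 1) ha (by omega) ham _
      (h.N_anti (by omega) (hg _ m ham le_rfl) (hgt m le_rfl).le hz')

/-- If the vertices of each `N i` that still matter are complete to the later cliques `X j`, then
the last stage is easy to colour. -/
theorem Tower.col_of_complete {ℓ τ K c : ℕ} (hk : 0 < k) (hG : Tame ℓ τ K G)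
    (hS : NoPair G S k c) (h : Tower G S t C N X w) {r : ℕ} (hr : 2 ≤ r)
    (hr' : ∀ n, r + 2 ≤ n → ¬ InducedCycle G n) {g : ℕ → ℕ}
    (hg : ∀ a b, a < b → b ≤ r → g a < g b) (hgt : ∀ a ≤ r, g a < t)
    (hX : ∀ a b, a < b → b ≤ r → ∀ n ∈ N (g b) (g a), (∃ u ∈ C (g b + 1), G.Adj n u) →
      ∀ e, G.Adj n (X (g b) e)) : Col G (C t) (r * (c + (k + 1) * (τ + 1))) := by
  classical
  by_contra hcol
  have hstep := fun a (ha : a ≤ r) => h.step (g a) (hgt a ha)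
  have hchain : ∀ s ≤ r, ∀ v ∈ N (g s + 1) (g s), ∃ y : ℕ → V, y s = v ∧ ∀ a < s,
      y a ∈ N (g (a + 1)) (g a) ∧ G.Adj (y a) (y (a + 1)) ∧
      ∃ e, ¬ G.Adj (y a) (X (g (a + 1)) e) := by
    intro s
    induction s with
    | zero => exact fun _ v _ => ⟨fun _ => v, rfl, by simp⟩
    | succ s ih =>
      intro hs v hv
      have g1 := hg s (s + 1) (by omega) hs
      obtain ⟨n, hn, hnv, he⟩ := (hstep (s + 1) hs).link (g s) g1 v hv
      obtain ⟨y, hys, hy⟩ := ih (by omega) n (h.N_anti (by omega) g1 (hgt _ hs).le hn)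
      have e1 : ∀ a ≤ s, (if a = s + 1 then v else y a) = y a := fun a ha => if_neg (by omega)
      refine ⟨fun a => if a = s + 1 then v else y a, by simp, fun a ha => ?_⟩
      dsimp only
      rw [e1 a (by omega)]
      rcases Nat.lt_succ_iff_lt_or_eq.1 ha with ha | rfl
      · rw [e1 (a + 1) ha]
        exact hy a ha
      · rw [if_pos rfl, hys]
        exact ⟨hn, hnv, he⟩
  obtain ⟨u₀, hu₀⟩ := nonempty_of_not_col hcol
  have gr := hgt r le_rfl
  obtain ⟨yr, hyr, -⟩ := (hstep r le_rfl).cover (g r) le_rfl u₀ (h.C_anti gr le_rfl hu₀)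
  obtain ⟨y, hyr', hy⟩ := hchain r le_rfl yr hyr
  have hyN : ∀ a ≤ r, y a ∈ N (g a + 1) (g a) := by
    intro a ha
    rcases Nat.lt_or_eq_of_le ha with ha | rfl
    · exact h.N_anti (by omega) (hg a (a + 1) (by omega) ha) (hgt _ ha).le (hy a ha).1
    · exact hyr' ▸ hyr
  have hyX : ∀ a ≤ r, ∀ e, G.Adj (y a) (X (g a) e) := fun a ha =>
    (hstep a ha).complete _ (hyN a ha)
  have hyC : ∀ a ≤ r, y a ∈ C (g a) := fun a ha => (hstep a ha).new (hyN a ha)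
  have hyC' : ∀ a b, a < b → b ≤ r → y b ∈ C (g a + 1) := fun a b hab hb =>
    h.C_anti (hg a b hab hb) (hgt b hb).le (hyC b hb)
  have hyanti : ∀ a < r, ∀ u ∈ C (g (a + 1) + 1), ¬ G.Adj (y a) u := by
    intro a ha u hu hyu
    obtain ⟨hyN, -, e, he⟩ := hy a ha
    exact he (hX a (a + 1) (by omega) ha _ hyN ⟨u, hu, hyu⟩ e)
  have hNX : ∀ n ∈ N t (g 0), (∃ u ∈ C t, G.Adj n u) → ∀ a ≤ r, ∀ e, G.Adj n (X (g a) e) := by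
    intro n hn hu a ha
    rcases Nat.eq_zero_or_pos a with rfl | ha0
    · exact h.N_adj (hgt 0 ha) le_rfl hn
    · exact hX 0 a ha0 ha n (h.N_anti (hg 0 a ha0 ha) (hgt a ha).le le_rfl hn)
        (hu.imp fun u hu => ⟨h.C_anti (hgt a ha) le_rfl hu.1, hu.2⟩)
  have hSt := h.stage t le_rfl
  have hCS : ∀ a ≤ r, C (g a) ⊆ S := fun a ha => (h.stage _ (hgt a ha).le).sub
  have hbig := not_col_diff (Finset.Icc 1 r)
    (fun a => {u ∈ C t | ∃ n ∈ N t (g 0), G.Adj n u ∧ G.Adj n (y a)})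
    (n := 0) (c := c + (k + 1) * (τ + 1)) (by simpa using hcol) (fun a ha => by
      obtain ⟨-, ha⟩ := Finset.mem_Icc.1 ha
      exact hS.col_close hG (hstep a ha).clique (fun e => hCS a ha ((hstep a ha).mem e))
        (hCS a ha (hyC a ha)) (hyX a ha) (hSt.subN _ (hgt 0 (by omega))) hSt.sub
        fun n hn hu _ => hNX n hn hu a ha)
  obtain ⟨u, hu, hua⟩ := nonempty_of_not_col hbig
  obtain ⟨n, hn, hnu⟩ := hSt.cover (g 0) (hgt 0 (by omega)) u hu
  have hnX := hNX n hn ⟨u, hu, hnu⟩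
  obtain ⟨-, -, e, he⟩ := hy (r - 1) (by omega)
  rw [show r - 1 + 1 = r by omega] at he
  obtain ⟨l, hl, hl'⟩ := exists_inducedCycle_of_seq hr y (G := G) (x := X (g 0) ⟨0, hk⟩) (n := n)
    (v := X (g r) e) (fun a ha => (hy a ha).2.1)
    (fun a b hab hb => hyanti a (by omega) _ (hyC' (a + 1) b hab hb))
    (hyX 0 (by omega) _).symm
    (fun a ha har => (hstep 0 (by omega)).anti _ _ (hyC' 0 a ha har))
    (hyX r le_rfl e).symm (by
      intro a ha
      refine ⟨fun heq => ?_, fun hadj => ?_⟩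
      · exact ((hstep a ha.le).anti e _ (h.X_mem (hg a r ha le_rfl) gr e)).2
          (heq ▸ (hyX a ha.le e).symm)
      · by_cases har : a + 1 = r
        · obtain rfl : a = r - 1 := by omega
          exact he hadj.symm
        · exact hyanti a ha _ (h.X_mem (hg (a + 1) r (by omega) le_rfl) gr e) hadj.symm)
    (hnX 0 (by omega) _) (hnX r le_rfl e)
    (fun a ha har hna => hua a (Finset.mem_Icc.2 ⟨ha, har⟩) ⟨hu, n, hn, hnu, hna⟩)
  exact hr' l hl hl'

end Towers

theorem HasPairs.succ {ℓ τ K k : ℕ} (hk : 0 < k) (hP : HasPairs ℓ τ K k) :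
    HasPairs ℓ τ K (k + 1) := by
  classical
  intro c
  set m := 2 * (K + 1) + ℓ + 5 with hm
  obtain ⟨t, ht⟩ := ramsey_triples ((Fin k → Prop) × (Fin k → Prop)) m
  obtain ⟨M, hM⟩ := exists_tower hk hP c t ((ℓ + 2) * (c + (k + 1) * (τ + 1)))
  refine ⟨M, fun V G hG S hS => ?_⟩
  by_contra hcon
  have hno : NoPair G S k c := by
    intro X N C hXN hX hN hC
    by_contra hcol
    exact hcon ⟨X, N, C, hXN, hX, hN, hC, hcol⟩
  obtain ⟨C, N, X, w, hT, hcol⟩ := hM V G hG S hno hS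
  obtain ⟨g, hg, hgt, ⟨P, Q⟩, hPQ⟩ := ht fun i h j =>
    (fun e => ∀ n ∈ N (h + 1) i, ¬ G.Adj n (X h e),
      fun e => ∀ n ∈ N (j + 1) i, ¬ G.Adj n (w j h e))
  have hP' : ∀ e a b, a < b → b + 1 < m →
      ((∀ n ∈ N (g b + 1) (g a), ¬ G.Adj n (X (g b) e)) ↔ P e) := fun e a b hab hb =>
    iff_of_eq (congrFun (congrArg Prod.fst (hPQ a b (b + 1) hab (by omega) hb)) e)
  have hQ' : ∀ e a b c, a < b → b < c → c < m →
      ((∀ n ∈ N (g c + 1) (g a), ¬ G.Adj n (w (g c) (g b) e)) ↔ Q e) :=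
    fun e a b c hab hbc hc =>
      iff_of_eq (congrFun (congrArg Prod.snd (hPQ a b c hab hbc hc)) e)
  by_cases hQ : ∀ e, Q e
  · by_cases hPe : ∃ e, P e
    · obtain ⟨e, he⟩ := hPe
      obtain ⟨l, hl, hl'⟩ := hT.exists_inducedCycle_of_anti (m := ℓ + 3) (by omega)
        (fun a b hab hb => hg a b hab (by omega)) (fun a ha => hgt a (by omega)) e
        (fun a b hab hb => (hP' e a b hab (by omega)).2 he)
        (fun a b c hab hbc hc => (hQ' e a b c hab hbc (by omega)).2 (hQ e))
      exact hG.hole l (by omega) hl'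
    · refine hcol (hT.col_of_complete hk hG hno (by omega)
        (fun n hn => hG.hole n (by omega)) (fun a b hab hb => hg a b hab (by omega))
        (fun a ha => hgt a (by omega)) fun a b hab hb => ?_)
      rcases (hT.step (g b) (hgt b (by omega))).uniform (g a) (hg a b hab (by omega))
        with ⟨e, he⟩ | h
      · exact absurd ⟨e, (hP' e a b hab (by omega)).1 he⟩ hPe
      · exact h
  · push Not at hQ
    obtain ⟨e, he⟩ := hQ
    refine hT.false_of_complete hG (fun a b hab hb => hg a b hab (by omega))
      (fun a ha => hgt a (by omega)) e fun a b c hab hbc hc => ?_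
    by_contra! hno'
    exact he ((hQ' e a b c hab hbc (by omega)).1 hno')

theorem hasPairs (ℓ τ K k : ℕ) : HasPairs ℓ τ K (k + 1) := by
  induction k with
  | zero => exact hasPairs_one ℓ τ K
  | succ k ih => exact ih.succ k.succ_pos

theorem exists_col_of_tame (ℓ τ K : ℕ) :
    ∃ M, ∀ (V : Type) (G : SimpleGraph V), Tame ℓ τ K G → Col G Set.univ M := by
  rcases K with _ | K
  · refine ⟨0, fun V G hG => ⟨fun _ => 0, fun v _ => ?_, fun v _ => ?_⟩⟩ <;>
    · have := hG.clique {v} (by simp)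
      simp at this
  obtain ⟨M, hM⟩ := hasPairs ℓ τ (K + 1) K 0
  refine ⟨M, fun V G hG => ?_⟩
  by_contra hcol
  obtain ⟨X, N, C, hX, -, -, -, hC⟩ := hM V G hG _ hcol
  obtain ⟨u, hu⟩ := nonempty_of_not_col hC
  obtain ⟨n, hn, -⟩ := hX.cover u hu
  refine hG.no_clique (Fin.cons n X) fun a b hab => ?_
  cases b using Fin.cases with
  | zero => exact absurd hab (Fin.not_lt_zero _)
  | succ b =>
    cases a using Fin.cases with
    | zero => simpa using hX.complete n hn b
    | succ a => simpa using hX.clique a b fun h => absurd hab (h ▸ lt_irrefl _)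

theorem inducedCycle_map {V W : Type*} {G : SimpleGraph V} {H : SimpleGraph W} (f : G ↪g H) {n : ℕ}
    (h : InducedCycle G n) : InducedCycle H n := by
  obtain ⟨p, hp, hadj⟩ := h
  exact ⟨f ∘ p, f.injective.comp hp, fun i j => f.map_adj_iff.trans (hadj i j)⟩

theorem exists_col (ℓ K : ℕ) : ∃ M, ∀ (V : Type) (G : SimpleGraph V),
    (∀ s : Finset V, G.IsClique (s : Set V) → s.card ≤ K) →
    (∀ n : ℕ, ℓ < n → ¬ InducedCycle G n) → Col G Set.univ M := by
  classical
  induction K with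
  | zero =>
    obtain ⟨M, hM⟩ := exists_col_of_tame ℓ 0 0
    refine ⟨M, fun V G hG hG' => hM V G ⟨hG', fun v => ?_, hG⟩⟩
    have := hG {v} (by simp)
    simp at this
  | succ K ih =>
    obtain ⟨τ, hτ⟩ := ih
    obtain ⟨M, hM⟩ := exists_col_of_tame ℓ τ (K + 1)
    refine ⟨M, fun V G hG hG' => hM V G ⟨hG', fun v => ?_, hG⟩⟩
    obtain ⟨f, hf, hf'⟩ := hτ _ (G.induce (G.neighborSet v)) (fun s hs => by
      have hv : v ∉ s.map (Function.Embedding.subtype _) := by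
        intro h
        obtain ⟨x, -, hx⟩ := Finset.mem_map.1 h
        have h1 : G.Adj v x.1 := x.2
        rw [show x.1 = v from hx] at h1
        exact G.irrefl h1
      have := hG (insert v (s.map (Function.Embedding.subtype _))) (by
        rw [Finset.coe_insert, SimpleGraph.isClique_insert]
        refine ⟨?_, ?_⟩
        · intro a ha b hb hab
          obtain ⟨x, hx, rfl⟩ := Finset.mem_map.1 ha
          obtain ⟨y, hy, rfl⟩ := Finset.mem_map.1 hb
          exact hs hx hy fun h => hab (h ▸ rfl)
        · intro b hb _
          obtain ⟨x, hx, rfl⟩ := Finset.mem_map.1 hb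
          exact x.2)
      rw [Finset.card_insert_of_notMem hv, Finset.card_map] at this
      omega) (fun n hn hc => hG' n hn (inducedCycle_map (SimpleGraph.Embedding.induce _) hc))
    refine ⟨fun u => if h : u ∈ G.neighborSet v then f ⟨u, h⟩ else 0, fun u hu => ?_,
      fun u hu u' hu' huu' => ?_⟩
    · simpa only [dif_pos hu] using hf ⟨u, hu⟩ trivial
    · simpa only [dif_pos hu, dif_pos hu'] using hf' ⟨u, hu⟩ trivial ⟨u', hu'⟩ trivial huu'

theorem chromaticNumber_le_of_col {V : Type*} {G : SimpleGraph V} {M : ℕ}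
    (h : Col G Set.univ M) : G.chromaticNumber ≤ (M : ℕ∞) := by
  obtain ⟨f, hf, hf'⟩ := h
  exact SimpleGraph.Colorable.chromaticNumber_le ⟨SimpleGraph.Coloring.mk
    (fun v => (⟨f v, hf v trivial⟩ : Fin M))
    fun {u v} huv heq => hf' u trivial v trivial huv (Fin.mk.inj_iff.1 heq)⟩

end HoleColoring

/-- For all `k, ℓ > 0` there exists `c` such that every finite graph with no clique of
cardinality more than `k` and no induced cycle of length more than `ℓ` has chromatic
number at most `c`. -/
theorem stmt0 (k ℓ : ℕ) (hk : 0 < k) (hℓ : 0 < ℓ) :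
    ∃ c : ℕ, ∀ (V : Type) [Fintype V] (G : SimpleGraph V),
      (∀ s : Finset V, G.IsClique (s : Set V) → s.card ≤ k) →
      (∀ n : ℕ, ℓ < n → ¬ InducedCycle G n) →
      G.chromaticNumber ≤ (c : ℕ∞) := by
  obtain ⟨M, hM⟩ := HoleColoring.exists_col ℓ k
  exact ⟨M, fun V _ G hclique hhole =>
    HoleColoring.chromaticNumber_le_of_col (hM V G hclique hhole)⟩
end

section
/- Let ℓ ≥ 4, κ ≥ 0, τ ≥ 0 be integers, and let G be a graph with no hole of length at least ℓ, such that for every vertex v, the subgraph induced on the neighbors of v has chromatic number at most κ, and the subgraph induced on the second neighborhood N²(v) has chromatic number at most τ. Then χ(G) ≤ 2(ℓ−3)(κ+τ)+1. -/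
/-- The second neighbourhood of a vertex: vertices at distance exactly two. -/
def N2 {V : Type*} (G : SimpleGraph V) (v : V) : Set V :=
  {u | u ≠ v ∧ ¬ G.Adj v u ∧ ∃ w, G.Adj v w ∧ G.Adj w u}

section InducedPaths

open SimpleGraph

variable {V : Type*}

/-- `f 0, …, f n` are the vertices, in order, of an induced path of length `n`. -/
structure IsInducedPath (G : SimpleGraph V) (n : ℕ) (f : ℕ → V) : Prop where
  inj : ∀ i j, i ≤ n → j ≤ n → f i = f j → i = j
  adj_iff : ∀ i j, i ≤ n → j ≤ n → (G.Adj (f i) (f j) ↔ j = i + 1 ∨ i = j + 1)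

theorem IsInducedPath.append {G : SimpleGraph V} {m n : ℕ} {f g : ℕ → V}
    (hf : IsInducedPath G m f) (hg : IsInducedPath G n g) (h0 : f m = g 0)
    (hne : ∀ s t, s < m → 0 < t → t ≤ n → f s ≠ g t)
    (hadj : ∀ s t, s < m → 0 < t → t ≤ n → ¬ G.Adj (f s) (g t)) :
    IsInducedPath G (m + n) (fun t => if t ≤ m then f t else g (t - m)) := by
  have key : ∀ i j, i ≤ m → m < j → j ≤ m + n →
      f i ≠ g (j - m) ∧ (G.Adj (f i) (g (j - m)) ↔ j = i + 1) := by
    intro i j hi hj hjn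
    rcases Nat.lt_or_eq_of_le hi with h | rfl
    · refine ⟨hne i _ h (by omega) (by omega), ?_⟩
      have := hadj i (j - m) h (by omega) (by omega)
      constructor
      · intro h'; exact absurd h' this
      · omega
    · rw [h0]
      refine ⟨fun h => ?_, ?_⟩
      · have := hg.inj _ _ (by omega) (by omega) h
        omega
      · rw [hg.adj_iff _ _ (by omega) (by omega)]
        omega
  constructor
  · intro i j hi hj h
    beta_reduce at h
    split_ifs at h with h1 h2 h2
    · exact hf.inj _ _ h1 h2 h
    · exact absurd h (key i j h1 (by omega) hj).1
    · exact absurd h.symm (key j i h2 (by omega) hi).1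
    · have := hg.inj _ _ (by omega) (by omega) h
      omega
  · intro i j hi hj
    split_ifs with h1 h2 h2
    · exact hf.adj_iff _ _ h1 h2
    · rw [(key i j h1 (by omega) hj).2]; omega
    · rw [G.adj_comm, (key j i h2 (by omega) hi).2]; omega
    · rw [hg.adj_iff _ _ (by omega) (by omega)]; omega

theorem ZMod.eq_add_one_iff_val {n : ℕ} [NeZero n] (hn : 2 ≤ n) (i j : ZMod n) :
    j = i + 1 ↔ j.val = i.val + 1 ∨ (j.val = 0 ∧ i.val + 1 = n) := by
  have : Fact (1 < n) := ⟨by omega⟩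
  have hi := ZMod.val_lt i
  have hj := ZMod.val_lt j
  rw [← (ZMod.val_injective n).eq_iff, ZMod.val_add, ZMod.val_one]
  rcases Nat.lt_or_ge (i.val + 1) n with h | h
  · rw [Nat.mod_eq_of_lt h]; omega
  · have : i.val + 1 = n := by omega
    rw [this, Nat.mod_self]; omega

/-- Two induced paths with common ends and anticomplete interiors form a hole. -/
theorem IsInducedPath.inducedCycle {G : SimpleGraph V} {a b : ℕ} {f g : ℕ → V}
    (hf : IsInducedPath G a f) (hg : IsInducedPath G b g) (ha : 2 ≤ a) (hb : 2 ≤ b)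
    (h0 : f 0 = g 0) (h1 : f a = g b)
    (hne : ∀ s t, 0 < s → s < a → 0 < t → t < b → f s ≠ g t)
    (hadj : ∀ s t, 0 < s → s < a → 0 < t → t < b → ¬ G.Adj (f s) (g t)) :
    InducedCycle G (a + b) := by
  have : NeZero (a + b) := ⟨by omega⟩
  have key : ∀ s t, s ≤ a → 0 < t → t < b →
      f s ≠ g t ∧ (G.Adj (f s) (g t) ↔ (s = 0 ∧ t = 1) ∨ (s = a ∧ t + 1 = b)) := by
    intro s t hs ht htb
    rcases Nat.eq_zero_or_pos s with rfl | hs0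
    · rw [h0]
      refine ⟨fun h => ?_, ?_⟩
      · have := hg.inj _ _ (by omega) (by omega) h
        omega
      · rw [hg.adj_iff _ _ (by omega) (by omega)]; omega
    rcases Nat.lt_or_eq_of_le hs with h | rfl
    · refine ⟨hne s t hs0 h ht htb, ?_⟩
      have := hadj s t hs0 h ht htb
      constructor
      · intro h'; exact absurd h' this
      · omega
    · rw [h1]
      refine ⟨fun h => ?_, ?_⟩
      · have := hg.inj _ _ (by omega) (by omega) h
        omega
      · rw [hg.adj_iff _ _ (by omega) (by omega)]; omega
  refine ⟨fun i => if i.val ≤ a then f i.val else g (a + b - i.val), ?_, ?_⟩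
  · intro i j h
    have hi := ZMod.val_lt i
    have hj := ZMod.val_lt j
    apply ZMod.val_injective
    beta_reduce at h
    split_ifs at h with h1 h2 h2
    · exact hf.inj _ _ h1 h2 h
    · exact absurd h (key _ _ h1 (by omega) (by omega)).1
    · exact absurd h.symm (key _ _ h2 (by omega) (by omega)).1
    · have := hg.inj _ _ (by omega) (by omega) h
      omega
  · intro i j
    have hi := ZMod.val_lt i
    have hj := ZMod.val_lt j
    rw [ZMod.eq_add_one_iff_val (by omega), ZMod.eq_add_one_iff_val (by omega)]
    beta_reduce
    split_ifs with h1 h2 h2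
    · rw [hf.adj_iff _ _ h1 h2]; omega
    · rw [(key _ _ h1 (by omega) (by omega)).2]; omega
    · rw [G.adj_comm, (key _ _ h2 (by omega) (by omega)).2]; omega
    · rw [hg.adj_iff _ _ (by omega) (by omega)]; omega

theorem exists_isInducedPath_of_reachable {W : Type*} (H : SimpleGraph W) {u v : W}
    (h : H.Reachable u v) : ∃ n f, IsInducedPath H n f ∧ f 0 = u ∧ f n = v := by
  obtain ⟨p, hp⟩ := h.exists_walk_length_eq_dist
  have hd : ∀ i ≤ p.length, H.dist u (p.getVert i) = i := by
    intro i hi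
    have h1 := dist_le (p.take i)
    have h2 := dist_le (p.drop i)
    have h3 := (p.take i).reachable.dist_triangle_left v
    rw [Walk.take_length] at h1
    rw [Walk.drop_length] at h2
    omega
  refine ⟨p.length, p.getVert, ⟨?_, ?_⟩, p.getVert_zero, p.getVert_length⟩
  · intro i j hi hj hij
    rw [← hd i hi, hij, hd j hj]
  · intro i j hi hj
    constructor
    · intro hadj
      have hne : i ≠ j := by rintro rfl; exact H.loopless.irrefl _ hadj
      have := hadj.diff_dist_adj (u := u)
      rw [hd i hi, hd j hj] at this
      omega
    · rintro (rfl | rfl)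
      · exact p.adj_getVert_succ (by omega)
      · exact (p.adj_getVert_succ (by omega)).symm

theorem exists_isInducedPath_of_induce_reachable (G : SimpleGraph V) {S : Set V} {u v : S}
    (h : (G.induce S).Reachable u v) :
    ∃ n f, IsInducedPath G n f ∧ f 0 = u ∧ f n = v ∧ ∀ t, f t ∈ S := by
  obtain ⟨n, f, hf, h0, hn⟩ := exists_isInducedPath_of_reachable _ h
  refine ⟨n, fun t => f t, ⟨fun i j hi hj hij => hf.inj i j hi hj (Subtype.ext hij),
    fun i j hi hj => hf.adj_iff i j hi hj⟩, congrArg _ h0, congrArg _ hn, fun t => (f t).2⟩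

/-- Distances to a root chosen in every connected component. -/
theorem exists_level (G : SimpleGraph V) : ∃ lev : V → ℕ,
    (∀ u v, G.Adj u v → lev v ≤ lev u + 1) ∧
    (∀ v k, lev v = k + 1 → ∃ u, G.Adj u v ∧ lev u = k) ∧
    (∀ u v, lev u = 0 → lev v = 0 → G.Reachable u v → u = v) := by
  have hr : ∀ v, G.Reachable (G.connectedComponentMk v).out v := fun v =>
    ConnectedComponent.exact (Quot.out_eq _)
  refine ⟨fun v => G.dist (G.connectedComponentMk v).out v, ?_, ?_, ?_⟩
  · intro u v h
    have := h.diff_dist_adj (u := (G.connectedComponentMk v).out)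
    simp only [ConnectedComponent.sound h.reachable]
    omega
  · intro v k hk
    obtain ⟨p, hp⟩ := (hr v).exists_walk_length_eq_dist
    simp only at hk
    rw [hk] at hp
    have hadj : G.Adj (p.getVert k) v := by
      have := p.adj_getVert_succ (i := k) (by omega)
      rwa [← hp, p.getVert_length] at this
    refine ⟨_, hadj, ?_⟩
    simp only [ConnectedComponent.sound hadj.reachable]
    have h1 := dist_le (p.take k)
    rw [Walk.take_length] at h1
    have := hadj.diff_dist_adj (u := (G.connectedComponentMk v).out)
    omega
  · intro u v hu hv h
    rw [← (hr u).dist_eq_zero_iff.mp hu, ← (hr v).dist_eq_zero_iff.mp hv,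
      ConnectedComponent.sound h]

theorem colorable_induce_mono {G : SimpleGraph V} {A B : Set V} {n : ℕ} (h : A ⊆ B)
    (hB : (G.induce B).Colorable n) : (G.induce A).Colorable n :=
  hB.of_hom (G.induceHomOfLE h).toHom

theorem colorable_induce_union {G : SimpleGraph V} {A B : Set V} {m n : ℕ}
    (hA : (G.induce A).Colorable m) (hB : (G.induce B).Colorable n) :
    (G.induce (A ∪ B)).Colorable (m + n) := by
  classical
  obtain ⟨a⟩ := hA
  obtain ⟨b⟩ := hB
  let c : (G.induce (A ∪ B)).Coloring (Fin m ⊕ Fin n) := Coloring.mk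
    (fun x => if h : x.1 ∈ A then Sum.inl (a ⟨x, h⟩)
      else Sum.inr (b ⟨x, x.2.resolve_left h⟩)) (by
    intro x y hxy
    split_ifs with h1 h2 h2
    · exact fun h => a.valid (v := ⟨x, h1⟩) (w := ⟨y, h2⟩) hxy (Sum.inl_injective h)
    · simp
    · simp
    · exact fun h => b.valid (v := ⟨x, _⟩) (w := ⟨y, _⟩) hxy (Sum.inr_injective h))
  simpa using c.colorable

theorem colorable_induce_iUnion_lt {G : SimpleGraph V} {A : ℕ → Set V} {n : ℕ}
    (hA : ∀ j, (G.induce (A j)).Colorable n) (m : ℕ) :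
    (G.induce {x | ∃ j < m, x ∈ A j}).Colorable (m * n) := by
  induction m with
  | zero =>
    have : IsEmpty {x | ∃ j < 0, x ∈ A j} := ⟨by rintro ⟨x, j, hj, -⟩; omega⟩
    exact Colorable.of_isEmpty _
  | succ m ih =>
    rw [Nat.succ_mul]
    refine colorable_induce_mono ?_ (colorable_induce_union ih (hA m))
    rintro x ⟨j, hj, hx⟩
    rcases Nat.lt_succ_iff_lt_or_eq.mp hj with h | rfl
    · exact Or.inl ⟨j, h, hx⟩
    · exact Or.inr hx

theorem exists_component_not_colorable {G : SimpleGraph V} {C : Set V} {n : ℕ}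
    (h : ¬ (G.induce C).Colorable n) :
    ∃ D ⊆ C, (G.induce D).Connected ∧ ¬ (G.induce D).Colorable n ∧
      ∀ x ∈ D, ∀ y ∈ C, G.Adj x y → y ∈ D := by
  rw [colorable_iff_forall_connectedComponent] at h
  push Not at h
  obtain ⟨c, hc⟩ := h
  let e : c.toSimpleGraph →g G.induce (Subtype.val '' c.supp) :=
    { toFun := fun x => ⟨x.1.1, x.1, x.2, rfl⟩
      map_rel' := fun {x y} hxy => hxy }
  refine ⟨Subtype.val '' c.supp, ?_, ?_, ?_, ?_⟩
  · rintro _ ⟨x, -, rfl⟩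
    exact x.2
  · refine c.connected_toSimpleGraph.map e ?_
    rintro ⟨_, x, hx, rfl⟩
    exact ⟨⟨x, hx⟩, rfl⟩
  · exact fun h => hc (h.of_hom e)
  · rintro _ ⟨x, hx, rfl⟩ y hy hxy
    refine ⟨⟨y, hy⟩, ?_, rfl⟩
    have : (G.induce C).Adj x ⟨y, hy⟩ := hxy
    exact (c.mem_supp_congr_adj this).mp hx

theorem exists_adj_of_connected_of_ssubset {G : SimpleGraph V} {C D : Set V}
    (hC : (G.induce C).Connected) {x y : V} (hDC : D ⊆ C) (hx : x ∈ D) (hy : y ∈ C)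
    (hyD : y ∉ D) : ∃ a ∈ D, ∃ b ∈ C, b ∉ D ∧ G.Adj a b := by
  obtain ⟨p⟩ := hC.preconnected ⟨x, hDC hx⟩ ⟨y, hy⟩
  obtain ⟨d, -, h1, h2⟩ := p.exists_boundary_dart {z | z.1 ∈ D} hx hyD
  exact ⟨d.fst, h1, d.snd, d.snd.2, h2, d.adj⟩

/-- The Gyárfás path argument. -/
theorem exists_inducedPath_of_not_colorable {G : SimpleGraph V} {κ : ℕ}
    (hN1 : ∀ v, (G.induce (G.neighborSet v)).Colorable κ) {C₀ : Set V} {v₀ x₀ : V}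
    (hC₀ : (G.induce C₀).Connected) (hv₀ : v₀ ∉ C₀) (hx₀ : x₀ ∈ C₀) (hvx : G.Adj v₀ x₀)
    (m : ℕ) : ∀ N, ¬ (G.induce C₀).Colorable (N + m * κ) →
    ∃ (f : ℕ → V) (C : Set V), IsInducedPath G m f ∧ f 0 = v₀ ∧
      (∀ s, 0 < s → s ≤ m → f s ∈ C₀) ∧ C ⊆ C₀ ∧ (G.induce C).Connected ∧
      (∀ s ≤ m, f s ∉ C) ∧ (∀ s < m, ∀ x ∈ C, ¬ G.Adj (f s) x) ∧
      (∃ x ∈ C, G.Adj (f m) x) ∧ ¬ (G.induce C).Colorable N := by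
  induction m with
  | zero =>
    intro N hN
    refine ⟨fun _ => v₀, C₀, ⟨fun i j hi hj _ => by omega, fun i j hi hj => ?_⟩, rfl,
      fun s h h' => by omega, subset_rfl, hC₀, fun _ _ => hv₀, fun s hs => by omega,
      ⟨x₀, hx₀, hvx⟩, by simpa using hN⟩
    have : ¬ (j = i + 1 ∨ i = j + 1) := by omega
    simp [this]
  | succ m ih =>
    intro N hN
    obtain ⟨f, C, hf, hf0, hfC₀, hCC₀, hC, hfC, hfadj, ⟨x, hx, hfx⟩, hcol⟩ :=
      ih (N + κ) (by rwa [show N + κ + m * κ = N + (m + 1) * κ by ring])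
    have hcol' : ¬ (G.induce (C \ G.neighborSet (f m))).Colorable N := fun h =>
      hcol (colorable_induce_mono (by intro z hz; by_cases h : z ∈ G.neighborSet (f m) <;>
        simp_all) (colorable_induce_union h (hN1 (f m))))
    obtain ⟨D, hDC, hD, hDcol, hDmax⟩ := exists_component_not_colorable hcol'
    obtain ⟨⟨d, hd⟩⟩ := hD.nonempty
    have hDC' : D ⊆ C := hDC.trans Set.sdiff_subset
    obtain ⟨a, ha, b, hb, hbD, hab⟩ := exists_adj_of_connected_of_ssubset hC hDC' hd hx
      (fun h => (hDC h).2 hfx)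
    have hfb : G.Adj (f m) b := by
      by_contra h
      exact hbD (hDmax a ha b ⟨hb, h⟩ hab)
    have hb' : ∀ s ≤ m, f s ≠ b := by
      rintro s hs rfl
      exact hfC s hs hb
    refine ⟨fun s => if s ≤ m then f s else b, D, ⟨?_, ?_⟩, ?_, ?_, hDC'.trans hCC₀, hD, ?_,
      ?_, ?_, hDcol⟩
    · intro i j hi hj h
      beta_reduce at h
      split_ifs at h with h1 h2 h2
      · exact hf.inj i j h1 h2 h
      · exact absurd h (hb' i h1)
      · exact absurd h.symm (hb' j h2)
      · omega
    · have key : ∀ s ≤ m, G.Adj (f s) b ↔ s = m := by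
        intro s hs
        constructor
        · intro h
          by_contra hne
          exact hfadj s (by omega) b hb h
        · rintro rfl
          exact hfb
      intro i j hi hj
      split_ifs with h1 h2 h2
      · exact hf.adj_iff i j h1 h2
      · rw [key i h1]; omega
      · rw [G.adj_comm, key j h2]; omega
      · have : ¬ (j = i + 1 ∨ i = j + 1) := by omega
        simp [this]
    · simpa using hf0
    · intro s h0 hs
      beta_reduce
      split_ifs with h
      · exact hfC₀ s h0 h
      · exact hCC₀ hb
    · intro s hs
      beta_reduce
      split_ifs with h
      · exact fun h' => hfC s h (hDC' h')
      · exact hbD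
    · intro s hs y hy
      beta_reduce
      rw [if_pos (by omega)]
      rcases Nat.lt_or_eq_of_le (Nat.le_of_lt_succ hs) with h | rfl
      · exact hfadj s h y (hDC' hy)
      · exact (hDC hy).2
    · exact ⟨a, ha, by simpa using hab.symm⟩

theorem exists_reachable_level_zero {G : SimpleGraph V} {lev : V → ℕ}
    (hpar : ∀ v k, lev v = k + 1 → ∃ u, G.Adj u v ∧ lev u = k) {S : Set V} {k : ℕ}
    (hS : ∀ x, lev x < k → x ∈ S) (x : S) (hx : lev x ≤ k) :
    ∃ r : S, lev r = 0 ∧ (G.induce S).Reachable x r := by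
  obtain ⟨j, hj⟩ : ∃ j, lev x = j := ⟨_, rfl⟩
  induction j generalizing x with
  | zero => exact ⟨x, hj, Reachable.refl _⟩
  | succ j ih =>
    obtain ⟨u, hu, huj⟩ := hpar x j hj
    obtain ⟨r, hr, hur⟩ := ih ⟨u, hS u (by omega)⟩ (by change lev u ≤ k; omega) huj
    have hadj : (G.induce S).Adj x ⟨u, hS u (by omega)⟩ := hu.symm
    exact ⟨r, hr, hadj.reachable.trans hur⟩

theorem exists_isInducedPath_below_level {G : SimpleGraph V} {lev : V → ℕ}
    (hpar : ∀ v k, lev v = k + 1 → ∃ u, G.Adj u v ∧ lev u = k)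
    (hroot : ∀ u v, lev u = 0 → lev v = 0 → G.Reachable u v → u = v) {k : ℕ} {u v : V}
    (hu : lev u = k) (hv : lev v = k) (huv : G.Reachable u v) :
    ∃ n f, IsInducedPath G n f ∧ f 0 = u ∧ f n = v ∧ ∀ t, 0 < t → t < n → lev (f t) < k := by
  let S : Set V := {x | lev x < k ∨ x = u ∨ x = v}
  have hS : ∀ x, lev x < k → x ∈ S := fun x hx => Or.inl hx
  have huS : u ∈ S := Or.inr (Or.inl rfl)
  have hvS : v ∈ S := Or.inr (Or.inr rfl)
  obtain ⟨r, hr, hur⟩ := exists_reachable_level_zero hpar hS ⟨u, huS⟩ hu.le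
  obtain ⟨r', hr', hvr⟩ := exists_reachable_level_zero hpar hS ⟨v, hvS⟩ hv.le
  have h1 : G.Reachable u r := hur.map (Embedding.induce S).toHom
  have h2 : G.Reachable v r' := hvr.map (Embedding.induce S).toHom
  have hrr : r = r' := Subtype.ext (hroot _ _ hr hr' (h1.symm.trans (huv.trans h2)))
  subst hrr
  obtain ⟨n, f, hf, h0, hn, hfS⟩ :=
    exists_isInducedPath_of_induce_reachable G (hur.trans hvr.symm)
  refine ⟨n, f, hf, h0, hn, fun t ht htn => ?_⟩
  rcases hfS t with h | h | h
  · exact h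
  · have := hf.inj t 0 (by omega) (by omega) (h.trans h0.symm)
    omega
  · have := hf.inj t n (by omega) (by omega) (h.trans hn.symm)
    omega

theorem exists_isInducedPath_through {G : SimpleGraph V} {C : Set V}
    (hC : (G.induce C).Connected) {u v x y : V} (hx : x ∈ C) (hy : y ∈ C)
    (hux : G.Adj u x) (hyv : G.Adj y v) :
    ∃ n f, IsInducedPath G n f ∧ f 0 = u ∧ f n = v ∧ ∀ t, 0 < t → t < n → f t ∈ C := by
  let S : Set V := {z | z ∈ C ∨ z = u ∨ z = v}
  have hCS : C ⊆ S := fun z hz => Or.inl hz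
  have huS : u ∈ S := Or.inr (Or.inl rfl)
  have hvS : v ∈ S := Or.inr (Or.inr rfl)
  have h1 : (G.induce S).Adj ⟨u, huS⟩ ⟨x, hCS hx⟩ := hux
  have h2 : (G.induce S).Reachable ⟨x, hCS hx⟩ ⟨y, hCS hy⟩ :=
    (hC.preconnected ⟨x, hx⟩ ⟨y, hy⟩).map (G.induceHomOfLE hCS).toHom
  have h3 : (G.induce S).Adj ⟨y, hCS hy⟩ ⟨v, hvS⟩ := hyv
  obtain ⟨n, f, hf, h0, hn, hfS⟩ := exists_isInducedPath_of_induce_reachable G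
    (h1.reachable.trans (h2.trans h3.reachable))
  refine ⟨n, f, hf, h0, hn, fun t ht htn => ?_⟩
  rcases hfS t with h | h | h
  · exact h
  · have := hf.inj t 0 (by omega) (by omega) (h.trans h0.symm)
    omega
  · have := hf.inj t n (by omega) (by omega) (h.trans hn.symm)
    omega

theorem IsInducedPath.two_le {G : SimpleGraph V} {n : ℕ} {f : ℕ → V} {u v : V}
    (hf : IsInducedPath G n f) (h0 : f 0 = u) (hn : f n = v) (hne : u ≠ v)
    (hadj : ¬ G.Adj u v) : 2 ≤ n := by
  subst h0 hn
  by_contra h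
  obtain rfl | rfl : n = 0 ∨ n = 1 := by omega
  · exact hne rfl
  · exact hadj ((hf.adj_iff 0 1 (by omega) (by omega)).mpr (by omega))

theorem level_colorable {G : SimpleGraph V} {ℓ κ τ : ℕ} (hℓ : 4 ≤ ℓ)
    (hhole : ∀ n : ℕ, ℓ ≤ n → ¬ InducedCycle G n)
    (hN1 : ∀ v : V, (G.induce (G.neighborSet v)).Colorable κ)
    (hN2 : ∀ v : V, (G.induce (N2 G v)).Colorable τ) {lev : V → ℕ}
    (hadj : ∀ u v, G.Adj u v → lev v ≤ lev u + 1)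
    (hpar : ∀ v k, lev v = k + 1 → ∃ u, G.Adj u v ∧ lev u = k)
    (hroot : ∀ u v, lev u = 0 → lev v = 0 → G.Reachable u v → u = v) (k : ℕ) :
    (G.induce {x | lev x = k + 1}).Colorable ((ℓ - 3) * (κ + τ)) := by
  by_contra hnot
  obtain ⟨C₀, hC₀L, hC₀, hC₀col, -⟩ := exists_component_not_colorable hnot
  obtain ⟨m, rfl⟩ : ∃ m, ℓ = m + 4 := ⟨ℓ - 4, by omega⟩
  obtain ⟨⟨x₀, hx₀⟩⟩ := hC₀.nonempty
  obtain ⟨v₀, hvx, hv₀⟩ := hpar x₀ k (hC₀L hx₀)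
  have hv₀C : v₀ ∉ C₀ := fun h => by
    have : lev v₀ = k + 1 := hC₀L h
    omega
  obtain ⟨f, C, hf, hf0, hfC₀, hCC₀, hC, hfC, hfadj, ⟨x, hx, hfx⟩, hcol⟩ :=
    exists_inducedPath_of_not_colorable hN1 hC₀ hv₀C hx₀ hvx m (κ + (m + 1) * τ) (by
      rwa [show κ + (m + 1) * τ + m * κ = (m + 4 - 3) * (κ + τ) by
        rw [show m + 4 - 3 = m + 1 by omega]; ring])
  obtain ⟨w, hwC, hw⟩ : ∃ w ∈ C,
      w ∉ G.neighborSet (f m) ∪ {x | ∃ j < m + 1, x ∈ N2 G (f j)} := by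
    by_contra! h
    exact hcol (colorable_induce_mono h
      (colorable_induce_union (hN1 _) (colorable_induce_iUnion_lt (fun j => hN2 (f j)) _)))
  have hfw : ∀ s ≤ m, ¬ G.Adj (f s) w := by
    intro s hs
    rcases Nat.lt_or_eq_of_le hs with h | rfl
    · exact hfadj s h w hwC
    · exact fun h => hw (Or.inl h)
  obtain ⟨p, hpw, hp⟩ := hpar w k (hC₀L (hCC₀ hwC))
  have hfp : ∀ s ≤ m, f s ≠ p := by
    rintro s hs rfl
    exact hfw s hs hpw
  have hfpadj : ∀ s ≤ m, ¬ G.Adj (f s) p := by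
    intro s hs h
    refine hw (Or.inr ⟨s, by omega, ?_, hfw s hs, p, h, hpw⟩)
    rintro rfl
    exact hfC s hs hwC
  obtain ⟨n, g, hg, hg0, hgn, hgC⟩ := exists_isInducedPath_through hC hx hwC hfx hpw.symm
  have hn := hg.two_le hg0 hgn (hfp m le_rfl) (hfpadj m le_rfl)
  have hreach : G.Reachable v₀ p := by
    have : G.Reachable x₀ w := (hC₀.preconnected ⟨x₀, hx₀⟩ ⟨w, hCC₀ hwC⟩).map
      (Embedding.induce C₀).toHom
    exact hvx.reachable.trans (this.trans hpw.symm.reachable)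
  obtain ⟨b, h, hh, hh0, hhb, hhlev⟩ :=
    exists_isInducedPath_below_level hpar hroot hv₀ hp hreach
  have hb := hh.two_le hh0 hhb (hf0 ▸ hfp 0 (by omega)) (hf0 ▸ hfpadj 0 (by omega))
  have hmem : ∀ t, 0 < t → t ≤ n → g t ∈ C ∨ g t = p := by
    intro t ht htn
    rcases Nat.lt_or_eq_of_le htn with h | rfl
    · exact Or.inl (hgC t ht h)
    · exact Or.inr hgn
  have hfg := hf.append hg hg0.symm
    (by
      intro s t hs ht htn heq
      rcases hmem t ht htn with h | h
      · exact hfC s hs.le (heq ▸ h)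
      · exact hfp s hs.le (heq.trans h))
    (by
      intro s t hs ht htn hst
      rcases hmem t ht htn with h | h
      · exact hfadj s hs _ h hst
      · exact hfpadj s hs.le (h ▸ hst))
  have hlev : ∀ s, 0 < s → s < m + n → lev (if s ≤ m then f s else g (s - m)) = k + 1 := by
    intro s hs hsn
    split_ifs with h
    · exact hC₀L (hfC₀ s hs h)
    · exact hC₀L (hCC₀ (hgC (s - m) (by omega) (by omega)))
  refine hhole (m + n + b) (by omega) (hfg.inducedCycle hh (by omega) hb ?_ ?_ ?_ ?_)
  · simp [hf0, hh0]
  · rw [if_neg (by omega), Nat.add_sub_cancel_left, hgn, hhb]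
  · intro s t hs hsn ht htb heq
    have h1 := hlev s hs hsn
    have h2 := hhlev t ht htb
    rw [← heq] at h2
    omega
  · intro s t hs hsn ht htb hst
    have h1 := hlev s hs hsn
    have h2 := hhlev t ht htb
    have h3 := hadj _ _ hst.symm
    beta_reduce at h3
    omega

theorem colorable_of_levels {G : SimpleGraph V} {lev : V → ℕ} {n : ℕ}
    (hadj : ∀ u v, G.Adj u v → lev v ≤ lev u + 1)
    (hzero : ∀ u v, lev u = 0 → lev v = 0 → ¬ G.Adj u v)
    (hcol : ∀ k, (G.induce {x | lev x = k + 1}).Colorable n) :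
    G.Colorable (2 * n + 1) := by
  have hc := fun k => Classical.choice (hcol k)
  let c : G.Coloring (Option (Bool × Fin n)) := Coloring.mk
    (fun x => if h : lev x = 0 then none
      else some ((lev x).bodd, hc (lev x - 1) ⟨x, by change lev x = _; omega⟩)) (by
    intro x y hxy heq
    split_ifs at heq with h1 h2 h2
    · exact hzero x y h1 h2 hxy
    · have h3 := hadj x y hxy
      have h4 := hadj y x hxy.symm
      simp only [Option.some.injEq, Prod.mk.injEq] at heq
      obtain ⟨hpar, heq⟩ := heq
      have hl : lev x = lev y := by
        by_contra hne
        obtain h | h : lev x = lev y + 1 ∨ lev y = lev x + 1 := by omega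
        · simp [h] at hpar
        · simp [h] at hpar
      have key : ∀ j k (hx : lev x = j + 1) (hy : lev y = k + 1), j = k →
          hc j ⟨x, hx⟩ ≠ hc k ⟨y, hy⟩ := by
        rintro j _ hx hy rfl
        exact (hc j).valid hxy
      exact key _ _ (by omega) (by omega) (by rw [hl]) heq)
  simpa using c.colorable

end InducedPaths

/-- If `G` has no hole of length at least `ℓ` (`ℓ ≥ 4`), and every first neighbourhood has
chromatic number at most `κ` and every second neighbourhood has chromatic number at most `τ`,
then `χ(G) ≤ 2(ℓ-3)(κ+τ)+1`. -/
theorem stmt1 {V : Type} [Fintype V] (G : SimpleGraph V) (ℓ κ τ : ℕ) (hℓ : 4 ≤ ℓ)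
    (hhole : ∀ n : ℕ, ℓ ≤ n → ¬ InducedCycle G n)
    (hN1 : ∀ v : V, (G.induce (G.neighborSet v)).chromaticNumber ≤ (κ : ℕ∞))
    (hN2 : ∀ v : V, (G.induce (N2 G v)).chromaticNumber ≤ (τ : ℕ∞)) :
    G.chromaticNumber ≤ ((2 * (ℓ - 3) * (κ + τ) + 1 : ℕ) : ℕ∞) := by
  obtain ⟨lev, hadj, hpar, hroot⟩ := exists_level G
  simp only [SimpleGraph.chromaticNumber_le_iff_colorable] at hN1 hN2 ⊢
  rw [mul_assoc]
  refine colorable_of_levels hadj (fun u v hu hv huv => ?_)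
    (level_colorable hℓ hhole hN1 hN2 hadj hpar hroot)
  exact huv.ne (hroot u v hu hv huv.reachable)
end

section
/- Let ℓ ≥ 4, let k ≥ 1 and κ ≥ 0 be such that every graph H with no hole of length at least ℓ and clique number less than k satisfies χ(H) ≤ κ. Define φ₁(x) = 2(ℓ−3)(κ+x)+1. Then every graph G with no hole of length at least ℓ and ω(G) ≤ k is (1,φ₁)-clique-controlled: for every induced subgraph H of G and integer n ≥ 0, if χ(H) > φ₁(n) then some vertex v of H has χ(N²_H(v)) > n. -/
namespace SimpleGraph

variable {V : Type*}

/-- The spanning subgraph of `H` that keeps only the edges with both ends in `X`. -/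
def restrictTo (H : SimpleGraph V) (X : Set V) : SimpleGraph V where
  Adj x y := H.Adj x y ∧ x ∈ X ∧ y ∈ X
  symm := ⟨fun _ _ h => ⟨h.1.symm, h.2.2, h.2.1⟩⟩
  loopless := ⟨fun _ h => h.1.ne rfl⟩

/-- The subgraph of `H` induced on `X` has a proper colouring with `n` colours. -/
def ColorableOn (H : SimpleGraph V) (X : Set V) (n : ℕ) : Prop :=
  ∃ c : V → ℕ, (∀ x ∈ X, c x < n) ∧ ∀ x ∈ X, ∀ y ∈ X, H.Adj x y → c x ≠ c y

/-- The vertices `f 0, …, f p` form an induced path of `H`, in this order. -/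
def IsInducedPath (H : SimpleGraph V) (f : ℕ → V) (p : ℕ) : Prop :=
  ∀ i ≤ p, ∀ j ≤ p, (f i = f j → i = j) ∧ (H.Adj (f i) (f j) ↔ (j = i + 1 ∨ i = j + 1))

theorem restrictTo_mono (H : SimpleGraph V) {X Y : Set V} (h : X ⊆ Y) :
    H.restrictTo X ≤ H.restrictTo Y :=
  fun _ _ e => ⟨e.1, h e.2.1, h e.2.2⟩

theorem restrictTo_le (H : SimpleGraph V) (X : Set V) : H.restrictTo X ≤ H :=
  fun _ _ e => e.1

theorem colorableOn_iff (H : SimpleGraph V) (X : Set V) (n : ℕ) :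
    H.ColorableOn X n ↔ (H.induce X).Colorable n := by
  classical
  constructor
  · rintro ⟨c, hc, hc'⟩
    exact ⟨Coloring.mk (fun x => (⟨c x, hc x x.2⟩ : Fin n)) (by
      intro x y h e
      exact hc' x x.2 y y.2 h (by simpa using e))⟩
  · rintro ⟨c⟩
    refine ⟨fun x => if h : x ∈ X then (c ⟨x, h⟩ : ℕ) else 0, ?_, ?_⟩
    · intro x hx
      simp [hx]
    · intro x hx y hy h
      have := c.valid (v := ⟨x, hx⟩) (w := ⟨y, hy⟩) h
      simp only [hx, hy, dif_pos]
      exact fun e => this (Fin.ext e)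

theorem ColorableOn.mono {H : SimpleGraph V} {X Y : Set V} {n m : ℕ} (h : H.ColorableOn Y n)
    (hX : X ⊆ Y) (hn : n ≤ m) : H.ColorableOn X m := by
  obtain ⟨c, hc, hc'⟩ := h
  exact ⟨c, fun x hx => (hc x (hX hx)).trans_le hn, fun x hx y hy => hc' x (hX hx) y (hX hy)⟩

theorem ColorableOn.union {H : SimpleGraph V} {X Y : Set V} {n m : ℕ} (hX : H.ColorableOn X n)
    (hY : H.ColorableOn Y m) : H.ColorableOn (X ∪ Y) (n + m) := by
  classical
  obtain ⟨c, hc, hc'⟩ := hX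
  obtain ⟨e, he, he'⟩ := hY
  refine ⟨fun x => if x ∈ X then c x else n + e x, ?_, ?_⟩
  · intro x hx
    have := hc x
    have := he x
    simp only [Set.mem_union] at hx
    grind
  · intro x hx y hy h
    have h1 := hc x
    have h2 := hc y
    have h3 := hc' x
    have h4 := he' x
    simp only [Set.mem_union] at hx hy
    grind

theorem exists_component_not_colorableOn (H : SimpleGraph V) (X : Set V) (n : ℕ)
    (h : ¬ H.ColorableOn X n) :
    ∃ C ⊆ X, ¬ H.ColorableOn C n ∧ (∀ x ∈ C, ∀ y ∈ C, (H.restrictTo C).Reachable x y) ∧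
      ∀ x ∈ C, ∀ y ∈ X, H.Adj x y → y ∈ C := by
  by_contra! hcon
  apply h
  let K := (H.restrictTo X).connectedComponentMk
  have key : ∀ c, H.ColorableOn {x | x ∈ X ∧ K x = c} n := by
    intro c
    by_contra hc
    obtain ⟨x, ⟨hxX, hxc⟩, y, hy, hxy, hyc⟩ := hcon _ (fun x hx => hx.1) hc (by
      have walk : ∀ x y, (H.restrictTo X).Walk x y → K x = c →
          (H.restrictTo {x | x ∈ X ∧ K x = c}).Reachable x y := by
        intro x y w
        induction w with
        | nil => exact fun _ => Reachable.refl _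
        | @cons a b _ e w ih =>
          intro ha
          have hb : K b = c := (ConnectedComponent.eq.2 e.reachable.symm).trans ha
          have hab : (H.restrictTo {x | x ∈ X ∧ K x = c}).Adj a b :=
            ⟨e.1, ⟨e.2.1, ha⟩, e.2.2, hb⟩
          exact hab.reachable.trans (ih hb)
      intro x hx y hy
      obtain ⟨w⟩ := ConnectedComponent.eq.1 (hx.2.trans hy.2.symm)
      exact walk x y w hx.2)
    have e : (H.restrictTo X).Adj x y := ⟨hxy, hxX, hy⟩
    exact hyc ⟨hy, (ConnectedComponent.eq.2 e.reachable.symm).trans hxc⟩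
  choose c hc hc' using key
  refine ⟨fun x => c (K x) x, fun x hx => hc _ x ⟨hx, rfl⟩, ?_⟩
  intro x hx y hy hxy
  have e : (H.restrictTo X).Adj x y := ⟨hxy, hx, hy⟩
  have hK : K y = K x := ConnectedComponent.eq.2 e.reachable.symm
  simp only [hK]
  exact hc' _ x ⟨hx, rfl⟩ y ⟨hy, hK⟩ hxy

theorem exists_adj_mem_not_mem {G : SimpleGraph V} {Y : Set V} {x y : V} (w : G.Walk x y)
    (hx : x ∈ Y) (hy : y ∉ Y) : ∃ a ∈ Y, ∃ b ∉ Y, G.Adj a b := by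
  induction w with
  | nil => exact absurd hx hy
  | @cons a b _ e w ih =>
    by_cases hb : b ∈ Y
    · exact ih hb hy
    · exact ⟨a, hx, b, hb, e⟩

/-- Two vertices joined inside `X` are joined by an induced path inside `X`. -/
theorem Reachable.exists_isInducedPath {H : SimpleGraph V} {X : Set V} {a b : V} (ha : a ∈ X)
    (h : (H.restrictTo X).Reachable a b) :
    ∃ f p, f 0 = a ∧ f p = b ∧ (∀ i ≤ p, f i ∈ X) ∧ H.IsInducedPath f p := by
  obtain ⟨w, hw⟩ := h.exists_walk_length_eq_dist
  have hmem : ∀ i, w.getVert i ∈ X := by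
    have aux : ∀ {x y} (w : (H.restrictTo X).Walk x y), x ∈ X → ∀ i, w.getVert i ∈ X := by
      intro x y w
      induction w with
      | nil => intro hx i; simpa using hx
      | cons e w ih =>
        intro hx i
        cases i with
        | zero => simpa using hx
        | succ i => simpa using ih e.2.2 i
    exact aux w ha
  have hd : ∀ i ≤ w.length, (H.restrictTo X).dist a (w.getVert i) = i := by
    intro i hi
    have h1 := dist_le (w.take i)
    have h2 := dist_le (w.drop i)
    have h3 := (w.take i).reachable.dist_triangle_left (w := b)
    have h4 := w.take_length i
    have h5 := w.drop_length i
    omega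
  refine ⟨w.getVert, w.length, by simp, by simp, fun i _ => hmem i, ?_⟩
  intro i hi j hj
  refine ⟨fun e => by rw [← hd i hi, ← hd j hj, e], fun e => ?_, ?_⟩
  · have e' : (H.restrictTo X).Adj (w.getVert i) (w.getVert j) := ⟨e, hmem i, hmem j⟩
    have h1 := hd i hi
    have h2 := hd j hj
    have h3 := (w.take i).reachable.dist_triangle_left (w := w.getVert j)
    have h4 := (w.take j).reachable.dist_triangle_left (w := w.getVert i)
    have h5 := dist_eq_one_iff_adj.2 e'
    have h6 := dist_eq_one_iff_adj.2 e'.symm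
    have h7 : i ≠ j := by rintro rfl; exact e.ne rfl
    omega
  · rintro (rfl | rfl)
    · exact (w.adj_getVert_succ (by omega)).1
    · exact (w.adj_getVert_succ (by omega)).1.symm

/-- Two induced paths with the same ends and no other contact form a hole. -/
theorem IsInducedPath.inducedCycle {H : SimpleGraph V} {f g : ℕ → V} {p q : ℕ}
    (hf : H.IsInducedPath f p) (hg : H.IsInducedPath g q) (hp : 2 ≤ p) (hq : 2 ≤ q)
    (h0 : f 0 = g q) (h1 : f p = g 0)
    (hfg : ∀ i, 0 < i → i < p → ∀ j, 0 < j → j < q → f i ≠ g j ∧ ¬ H.Adj (f i) (g j)) :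
    InducedCycle H (p + q) := by
  have : NeZero (p + q) := ⟨by omega⟩
  have : Fact (1 < p + q) := ⟨by omega⟩
  have hsucc : ∀ i j : ZMod (p + q), j = i + 1 ↔
      (j.val = i.val + 1 ∨ (i.val + 1 = p + q ∧ j.val = 0)) := by
    intro i j
    have hi := ZMod.val_lt i
    have hj := ZMod.val_lt j
    rw [← (ZMod.val_injective (p + q)).eq_iff, ZMod.val_add, ZMod.val_one]
    rcases Nat.lt_or_ge (i.val + 1) (p + q) with h | h
    · rw [Nat.mod_eq_of_lt h]; omega
    · have : i.val + 1 = p + q := by omega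
      rw [this, Nat.mod_self]; omega
  let F : ℕ → V := fun i => if i ≤ p then f i else g (i - p)
  have hmix : ∀ i ≤ p, ∀ j, p < j → j < p + q → F i ≠ F j ∧
      (H.Adj (F i) (F j) ↔ (j = i + 1 ∨ (j + 1 = p + q ∧ i = 0))) := by
    intro i hi j hj hj'
    have e1 : F i = f i := if_pos hi
    have e2 : F j = g (j - p) := if_neg (by omega)
    rw [e1, e2]
    rcases Nat.eq_zero_or_pos i with rfl | hi0
    · have := hg q le_rfl (j - p) (by omega)
      rw [h0]
      refine ⟨fun e => by have := this.1 e; omega, ?_⟩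
      rw [this.2]; omega
    · rcases hi.lt_or_eq with hip | rfl
      · have := hfg i hi0 hip (j - p) (by omega) (by omega)
        refine ⟨this.1, iff_of_false this.2 (by omega)⟩
      · have := hg 0 (by omega) (j - i) (by omega)
        rw [h1]
        refine ⟨fun e => by have := this.1 e; omega, ?_⟩
        rw [this.2]; omega
  have hlow : ∀ i ≤ p, F i = f i := fun i hi => if_pos hi
  have hhigh : ∀ i, p < i → F i = g (i - p) := fun i hi => if_neg (by omega)
  have hF : ∀ i < p + q, ∀ j < p + q, (F i = F j → i = j) ∧
      (H.Adj (F i) (F j) ↔ ((j = i + 1 ∨ (i + 1 = p + q ∧ j = 0)) ∨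
        (i = j + 1 ∨ (j + 1 = p + q ∧ i = 0)))) := by
    intro i hi j hj
    rcases Nat.lt_or_ge p i with hip | hip <;> rcases Nat.lt_or_ge p j with hjp | hjp
    · rw [hhigh i hip, hhigh j hjp]
      have := hg (i - p) (by omega) (j - p) (by omega)
      refine ⟨fun e => by have := this.1 e; omega, ?_⟩
      rw [this.2]; omega
    · have := hmix j hjp i hip hi
      refine ⟨fun e => absurd e.symm this.1, ?_⟩
      rw [H.adj_comm, this.2]; omega
    · have := hmix i hip j hjp hj
      refine ⟨fun e => absurd e this.1, ?_⟩
      rw [this.2]; omega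
    · rw [hlow i hip, hlow j hjp]
      have := hf i hip j hjp
      refine ⟨this.1, ?_⟩
      rw [this.2]; omega
  refine ⟨fun i => F i.val, fun i j e => ?_, fun i j => ?_⟩
  · exact ZMod.val_injective _ ((hF _ (ZMod.val_lt i) _ (ZMod.val_lt j)).1 e)
  · rw [(hF _ (ZMod.val_lt i) _ (ZMod.val_lt j)).2, hsucc i j, hsucc j i]

/-- A variant of the Gyárfás path argument: in a connected set of large chromatic number,
there are a vertex `u` and a connected subset with a layering `d` starting at `v` such that
every vertex in the first `M` layers is at distance more than two from `u`. -/
theorem exists_layering_of_not_colorableOn {H : SimpleGraph V} {κ n : ℕ}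
    (hN : ∀ v, H.ColorableOn (H.neighborSet v) κ) (hN2 : ∀ v, H.ColorableOn (N2 H v) n)
    (M : ℕ) : ∀ (b : ℕ) (B C : Set V) (v : V),
      (∀ x ∈ C, ∀ y ∈ C, (H.restrictTo C).Reachable x y) → v ∉ C → (∃ x ∈ C, H.Adj v x) →
      H.ColorableOn B b → ¬ H.ColorableOn C (M * (κ + n) + b) →
      ∃ (D : Set V) (d : V → ℕ) (u : V), D ⊆ insert v C ∧ v ∈ D ∧ d v = 0 ∧
        (∀ x ∈ D, ∀ y ∈ D, H.Adj x y → d y ≤ d x + 1) ∧ u ∈ D ∧ u ∈ C ∧ u ∉ B ∧ d u = M ∧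
        (∀ x ∈ D, d x < M → u ≠ x ∧ ¬ H.Adj x u ∧ u ∉ N2 H x) ∧
        ∀ x ∈ D, (H.restrictTo D).Reachable v x := by
  classical
  induction M with
  | zero =>
    intro b B C v hC hv hvC hB hCB
    obtain ⟨u, huC, huB⟩ : ∃ u ∈ C, u ∉ B := by
      by_contra! h
      exact hCB (hB.mono h (by omega))
    obtain ⟨a, ha, hva⟩ := hvC
    refine ⟨insert v C, fun _ => 0, u, subset_rfl, Set.mem_insert _ _, rfl, by simp,
      Set.mem_insert_of_mem _ huC, huC, huB, rfl, by simp, ?_⟩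
    rintro x (rfl | hx)
    · exact Reachable.refl _
    · have e : (H.restrictTo (insert v C)).Adj v a :=
        ⟨hva, Set.mem_insert _ _, Set.mem_insert_of_mem _ ha⟩
      exact e.reachable.trans ((hC a ha x hx).mono (H.restrictTo_mono (Set.subset_insert _ _)))
  | succ M ih =>
    intro b B C v hC hv hvC hB hCB
    have hC' : ¬ H.ColorableOn (C \ H.neighborSet v) (M * (κ + n) + (b + n)) := by
      intro h
      refine hCB ((h.union (hN v)).mono ?_ (by ring_nf; omega))
      intro x hx
      by_cases hxv : x ∈ H.neighborSet v
      · exact Or.inr hxv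
      · exact Or.inl ⟨hx, hxv⟩
    obtain ⟨C₁, hC₁, hcol, hconn, hclosed⟩ := H.exists_component_not_colorableOn _ _ hC'
    obtain ⟨a, ha, hva⟩ := hvC
    obtain ⟨c, hc⟩ : C₁.Nonempty := by
      rw [Set.nonempty_iff_ne_empty]
      rintro rfl
      exact hcol ⟨fun _ => 0, by simp, by simp⟩
    obtain ⟨w⟩ := hC c (hC₁ hc).1 a ha
    obtain ⟨x, hx, v₁, hv₁, hxv₁⟩ := exists_adj_mem_not_mem w hc (fun h => (hC₁ h).2 hva)
    have hvv₁ : H.Adj v v₁ := by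
      by_contra h
      exact hv₁ (hclosed x hx v₁ ⟨hxv₁.2.2, h⟩ hxv₁.1)
    obtain ⟨D, d, u, hD, hvD, hdv, hlip, huD, huC, huB, hdu, hfar, hreach⟩ :=
      ih (b + n) (B ∪ N2 H v) C₁ v₁ hconn hv₁ ⟨x, hx, hxv₁.1.symm⟩ (hB.union (hN2 v)) hcol
    have hDC : D ⊆ C := fun y hy => by
      rcases hD hy with rfl | h
      · exact hxv₁.2.2
      · exact (hC₁ h).1
    have hne : ∀ y ∈ D, y ≠ v := fun y hy e => hv (e ▸ hDC hy)
    have hadj : ∀ y ∈ D, H.Adj v y → y = v₁ := fun y hy h =>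
      (hD hy).resolve_right fun h' => (hC₁ h').2 h
    simp only [Set.mem_union, not_or] at huB
    refine ⟨insert v D, fun y => if y = v then 0 else d y + 1, u,
      Set.insert_subset_insert hDC, Set.mem_insert _ _, if_pos rfl, ?_,
      Set.mem_insert_of_mem _ huD, (hC₁ huC).1, huB.1, ?_, ?_, ?_⟩
    · rintro y (rfl | hy) z (rfl | hz) h
      · simp
      · simp [hadj z hz h, hdv, hvv₁.ne']
      · simp
      · simpa [hne y hy, hne z hz] using hlip y hy z hz h
    · simp [hne u huD, hdu]
    · rintro y (rfl | hy) hlt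
      · exact ⟨hne u huD, (hC₁ huC).2, huB.2⟩
      · simp only [hne y hy, if_false] at hlt
        exact hfar y hy (by omega)
    · have e : (H.restrictTo (insert v D)).Adj v v₁ :=
        ⟨hvv₁, Set.mem_insert _ _, Set.mem_insert_of_mem _ hvD⟩
      rintro y (rfl | hy)
      · exact Reachable.refl _
      · exact e.reachable.trans ((hreach y hy).mono (H.restrictTo_mono (Set.subset_insert _ _)))

/-- The distance to a fixed root in each connected component. -/
theorem exists_distance_layering (H : SimpleGraph V) : ∃ d : V → ℕ,
    (∀ x y, H.Adj x y → d y ≤ d x + 1) ∧ (∀ x i, d x = i + 1 → ∃ y, H.Adj x y ∧ d y = i) ∧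
      ∀ x y, d x = 0 → d y = 0 → H.Reachable x y → x = y := by
  let r : V → V := fun x => (H.connectedComponentMk x).out
  have hr : ∀ x, H.Reachable x (r x) := fun x =>
    (ConnectedComponent.eq.1 (Quot.out_eq (H.connectedComponentMk x))).symm
  have hrr : ∀ x y, H.Reachable x y → r x = r y := fun x y h => by
    simp only [r, ConnectedComponent.eq.2 h]
  have hlip : ∀ x y, H.Adj x y → H.dist y (r y) ≤ H.dist x (r x) + 1 := by
    intro x y h
    rw [hrr x y h.reachable]
    have := h.symm.reachable.dist_triangle_left (w := r y)
    have := dist_eq_one_iff_adj.2 h.symm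
    omega
  refine ⟨fun x => H.dist x (r x), hlip, ?_, ?_⟩
  · intro x i hi
    obtain ⟨w, hw⟩ := (hr x).exists_walk_length_eq_dist
    have step : ∀ {z} (w : H.Walk x z), w.length = i + 1 → ∃ y, H.Adj x y ∧ H.dist y z ≤ i := by
      intro z w hw
      cases w with
      | nil => simp at hw
      | cons e w' => exact ⟨_, e, (dist_le w').trans (by simpa using hw.le)⟩
    obtain ⟨y, e, hy⟩ := step w (hw.trans hi)
    refine ⟨y, e, ?_⟩
    have := hlip y x e.symm
    rw [hrr x y e.reachable] at hy
    dsimp only at hi ⊢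
    omega
  · intro x y hx hy h
    have h1 := (hr x).dist_eq_zero_iff.1 hx
    have h2 := (hr y).dist_eq_zero_iff.1 hy
    rw [h1, h2, hrr x y h]

theorem exists_reachable_root {H : SimpleGraph V} {d : V → ℕ}
    (hd : ∀ x i, d x = i + 1 → ∃ y, H.Adj x y ∧ d y = i) (i : ℕ) :
    ∀ (x : V) (X : Set V), d x = i → x ∈ X → {y | d y < i} ⊆ X →
      ∃ r, d r = 0 ∧ (H.restrictTo X).Reachable x r := by
  induction i with
  | zero => exact fun x X hx _ _ => ⟨x, hx, Reachable.refl _⟩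
  | succ i ih =>
    intro x X hx hxX hX
    obtain ⟨y, hxy, hy⟩ := hd x i hx
    have hyX : y ∈ X := hX (by simp [hy])
    obtain ⟨r, hr, hyr⟩ := ih y X hy hyX (fun z hz => hX (Nat.lt_succ_of_lt hz))
    have e : (H.restrictTo X).Adj x y := ⟨hxy, hxX, hyX⟩
    exact ⟨r, hr, e.reachable.trans hyr⟩

theorem exists_layer_not_colorableOn {H : SimpleGraph V} {d : V → ℕ} {t : ℕ}
    (hlip : ∀ x y, H.Adj x y → d y ≤ d x + 1)
    (hroot : ∀ x y, d x = 0 → d y = 0 → H.Reachable x y → x = y)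
    (h : ¬ H.ColorableOn Set.univ (2 * t + 1)) : ∃ i, ¬ H.ColorableOn {x | d x = i + 1} t := by
  by_contra! hcon
  choose c hc hc' using hcon
  apply h
  have hlt : ∀ x, d x ≠ 0 → c (d x - 1) x < t := fun x hx => hc _ x (by simp; omega)
  refine ⟨fun x => if d x = 0 then 2 * t else if d x % 2 = 0 then c (d x - 1) x
    else t + c (d x - 1) x, ?_, ?_⟩
  · intro x _
    have := hlt x
    dsimp only
    split_ifs <;> omega
  · intro x _ y _ hxy
    have h1 := hlt x
    have h2 := hlt y
    have h3 := hlip x y hxy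
    have h4 := hlip y x hxy.symm
    have h5 : d x = 0 → d y ≠ 0 := fun hx hy => hxy.ne (hroot x y hx hy hxy.reachable)
    have h6 : d x ≠ 0 → d x = d y → c (d x - 1) x ≠ c (d y - 1) y := by
      intro hx e
      rw [← e]
      exact hc' _ x (by simp; omega) y (by simp; omega) hxy
    dsimp only
    split_ifs <;> omega

theorem colorableOn_univ_of_forall_N2 {H : SimpleGraph V} {ℓ κ n : ℕ} (hℓ : 4 ≤ ℓ)
    (hH : ∀ m, ℓ ≤ m → ¬ InducedCycle H m)
    (hN : ∀ v, H.ColorableOn (H.neighborSet v) κ) (hN2 : ∀ v, H.ColorableOn (N2 H v) n) :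
    H.ColorableOn Set.univ (2 * (ℓ - 3) * (κ + n) + 1) := by
  classical
  by_contra hcon
  rw [mul_assoc] at hcon
  obtain ⟨d, hlip, hpar, hroot⟩ := H.exists_distance_layering
  obtain ⟨j, hj⟩ := exists_layer_not_colorableOn hlip hroot hcon
  obtain ⟨C, hCj, hcol, hconn, -⟩ := H.exists_component_not_colorableOn _ _ hj
  obtain ⟨c, hc⟩ : C.Nonempty := by
    rw [Set.nonempty_iff_ne_empty]
    rintro rfl
    exact hcol ⟨fun _ => 0, by simp, by simp⟩
  have hdC : ∀ x ∈ C, d x = j + 1 := fun x hx => hCj hx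
  obtain ⟨v, hcv, hdv⟩ := hpar c j (hdC c hc)
  have hvC : v ∉ C := fun h => by have := hdC v h; omega
  obtain ⟨D, e, u, hD, hvD, hev, helip, huD, huC, -, heu, hfar, hreach⟩ :=
    exists_layering_of_not_colorableOn hN hN2 (ℓ - 3) 0 ∅ C v hconn hvC ⟨c, hc, hcv.symm⟩
      ⟨fun _ => 0, by simp, by simp⟩ hcol
  obtain ⟨w, huw, hdw⟩ := hpar u j (hdC u huC)
  have hfar' : ∀ x ∈ D, e x < ℓ - 3 → x ≠ w ∧ ¬ H.Adj x w := by
    intro x hx hlt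
    obtain ⟨h1, h2, h3⟩ := hfar x hx hlt
    exact ⟨fun h => h2 (h ▸ huw.symm), fun h => h3 ⟨h1, h2, w, h, huw.symm⟩⟩
  obtain ⟨hvw, hvw'⟩ := hfar' v hvD (by omega)
  have hwD : w ∉ D := fun h => by
    rcases hD h with rfl | h
    · exact hvw rfl
    · have := hdC w h; omega
  have hreach₁ : (H.restrictTo (insert w D)).Reachable v w := by
    have huw' : (H.restrictTo (insert w D)).Adj u w :=
      ⟨huw, Set.mem_insert_of_mem _ huD, Set.mem_insert _ _⟩
    exact ((hreach u huD).mono (H.restrictTo_mono (Set.subset_insert _ _))).trans huw'.reachable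
  have hreach₂ : (H.restrictTo ({x | d x < j} ∪ {v, w})).Reachable w v := by
    obtain ⟨r, hr, hwr⟩ := exists_reachable_root hpar j w ({x | d x < j} ∪ {v, w}) hdw
      (by simp) Set.subset_union_left
    obtain ⟨s, hs, hvs⟩ := exists_reachable_root hpar j v ({x | d x < j} ∪ {v, w}) hdv
      (by simp) Set.subset_union_left
    have hrs : r = s := hroot r s hr hs
      (((hwr.mono (H.restrictTo_le _)).symm.trans (hreach₁.mono (H.restrictTo_le _)).symm).trans
        (hvs.mono (H.restrictTo_le _)))
    exact hwr.trans (hrs ▸ hvs.symm)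
  obtain ⟨f, p, hf0, hfp, hfD, hf⟩ := hreach₁.exists_isInducedPath (Set.mem_insert_of_mem _ hvD)
  obtain ⟨g, q, hg0, hgq, hgE, hg⟩ := hreach₂.exists_isInducedPath (by simp)
  have hp : ℓ - 2 ≤ p := by
    let e' : V → ℕ := fun x => if x = w then ℓ - 2 else e x
    have hstep : ∀ i ≤ p, e' (f i) ≤ i := by
      intro i
      induction i with
      | zero => intro _; simp [e', hf0, hvw, hev]
      | succ i ih =>
        intro hi
        have h1 := ih (by omega)
        have hadj := ((hf i (by omega) (i + 1) hi).2).2 (Or.inl rfl)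
        have hne : f i ≠ w := fun h => by
          have := (hf i (by omega) p le_rfl).1 (h.trans hfp.symm)
          omega
        have hiD := (hfD i (by omega)).resolve_left hne
        simp only [e', hne, if_false] at h1
        by_cases hw : f (i + 1) = w
        · rw [hw] at hadj
          have : ¬ e (f i) < ℓ - 3 := fun h => (hfar' _ hiD h).2 hadj
          simp only [e', hw, if_true]
          omega
        · have := helip _ hiD _ ((hfD (i + 1) hi).resolve_left hw) hadj
          simp only [e', hw, if_false]
          omega
    simpa [e', hfp] using hstep p le_rfl
  have hq : 2 ≤ q := by
    by_contra hq
    obtain rfl | rfl : q = 0 ∨ q = 1 := by omega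
    · exact hvw (hgq.symm.trans hg0)
    · apply hvw'
      rw [← hg0, ← hgq]
      exact ((hg 1 le_rfl 0 (by omega)).2).2 (Or.inr rfl)
  refine hH (p + q) (by omega) (hf.inducedCycle hg (by omega) hq (hf0.trans hgq.symm)
    (hfp.trans hg0.symm) ?_)
  intro i hi0 hip k hk0 hkq
  have hfi : d (f i) = j + 1 := by
    rcases hfD i hip.le with h | h
    · have := (hf i hip.le p le_rfl).1 (h.trans hfp.symm)
      omega
    · rcases hD h with h | h
      · have := (hf i hip.le 0 (by omega)).1 (h.trans hf0.symm)
        omega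
      · exact hdC _ h
  have hgk : d (g k) < j := by
    rcases hgE k hkq.le with h | h | h
    · exact h
    · have := (hg k hkq.le q le_rfl).1 (h.trans hgq.symm)
      omega
    · have := (hg k hkq.le 0 (by omega)).1 (h.trans hg0.symm)
      omega
  refine ⟨fun h => by rw [h] at hfi; omega, fun h => ?_⟩
  have := hlip _ _ h.symm
  omega

end SimpleGraph

theorem InducedCycle.map {V W : Type*} {H : SimpleGraph W} {G : SimpleGraph V} {n : ℕ}
    (φ : H ↪g G) (h : InducedCycle H n) : InducedCycle G n := by
  obtain ⟨f, hf, hf'⟩ := h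
  exact ⟨fun i => φ (f i), φ.injective.comp hf, fun i j => by rw [φ.map_adj_iff, hf']⟩

/-- Let `ℓ ≥ 4` and `k ≥ 1, κ ≥ 0` be such that every graph with no hole of length at least
`ℓ` and clique number less than `k` is `κ`-chromatic. With `φ₁(x) = 2(ℓ-3)(κ+x)+1`, every
graph `G` with no hole of length at least `ℓ` and `ω(G) ≤ k` is `(1,φ₁)`-clique-controlled:
for every induced subgraph `H = G[S]` and `n ≥ 0` with `χ(H) > φ₁(n)`, some vertex `v` of
`H` has `χ(N²_H(v)) > n`. -/
theorem stmt10 (ℓ k κ : ℕ) (hℓ : 4 ≤ ℓ) (hk : 1 ≤ k)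
    (hκ : ∀ (W : Type) [Fintype W] (H : SimpleGraph W),
      (∀ n : ℕ, ℓ ≤ n → ¬ InducedCycle H n) →
      (∀ s : Finset W, H.IsClique (s : Set W) → s.card < k) →
      H.chromaticNumber ≤ (κ : ℕ∞))
    (V : Type) [Fintype V] (G : SimpleGraph V)
    (hG : ∀ n : ℕ, ℓ ≤ n → ¬ InducedCycle G n)
    (hωG : ∀ s : Finset V, G.IsClique (s : Set V) → s.card ≤ k) :
    ∀ (S : Set V) (n : ℕ),
      (((2 * (ℓ - 3) * (κ + n) + 1 : ℕ)) : ℕ∞) < (G.induce S).chromaticNumber →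
      ∃ v : S, ((n : ℕ∞) <
        ((G.induce S).induce (N2 (G.induce S) v)).chromaticNumber) := by
  classical
  intro S n hlt
  by_contra! hcon
  have hcol : (G.induce S).ColorableOn Set.univ (2 * (ℓ - 3) * (κ + n) + 1) := by
    refine SimpleGraph.colorableOn_univ_of_forall_N2 hℓ
      (fun m hm h => hG m hm (h.map (SimpleGraph.Embedding.induce S))) ?_ ?_
    · intro v
      rw [SimpleGraph.colorableOn_iff, ← SimpleGraph.chromaticNumber_le_iff_colorable]
      have := Fintype.ofFinite ((G.induce S).neighborSet v)
      let φ : (G.induce S).induce ((G.induce S).neighborSet v) ↪g G :=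
        (SimpleGraph.Embedding.induce S).comp (SimpleGraph.Embedding.induce _)
      refine hκ _ _ (fun m hm h => hG m hm (h.map φ)) fun s hs => ?_
      have hvs : (v : V) ∉ s.map φ.toEmbedding := by
        intro h
        obtain ⟨x, -, hx⟩ := Finset.mem_map.1 h
        exact (G.ne_of_adj x.2) hx.symm
      have hclique : G.IsClique (insert (v : V) (s.map φ.toEmbedding) : Finset V) := by
        rw [Finset.coe_insert, SimpleGraph.isClique_insert]
        constructor
        · intro a ha b hb hab
          obtain ⟨x, hx, rfl⟩ := Finset.mem_map.1 (Finset.mem_coe.1 ha)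
          obtain ⟨y, hy, rfl⟩ := Finset.mem_map.1 (Finset.mem_coe.1 hb)
          exact φ.map_adj_iff.2 (hs hx hy (fun h => hab (by rw [h])))
        · intro b hb _
          obtain ⟨y, -, rfl⟩ := Finset.mem_map.1 (Finset.mem_coe.1 hb)
          exact y.2
      have := hωG _ hclique
      rw [Finset.card_insert_of_notMem hvs, Finset.card_map] at this
      omega
    · intro v
      rw [SimpleGraph.colorableOn_iff, ← SimpleGraph.chromaticNumber_le_iff_colorable]
      exact hcon v
  rw [SimpleGraph.colorableOn_iff] at hcol
  have := (hcol.of_hom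
    (SimpleGraph.induceUnivIso (G.induce S)).symm.toHom)
  exact absurd hlt (not_lt.2 (SimpleGraph.chromaticNumber_le_iff_colorable.2 this))
end
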